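/- Let λ ∈ (0,1); let μ ≠ δ₀ be a symmetric Borel probability measure on ℝ that is ⊞_λ-infinitely divisible with rectangular R-transform C, and let ν, ρ be symmetric Borel probability measures on ℝ such that ρ is the rectangular free convolution μ ⊞_λ ν. Assume that the limit of C(x)²/x as x → −∞ exists in [−∞, 0] and is nonzero, and moreover that the restriction of C to ℂ⁺ extends continuously to (0,+∞) with boundary values C(x) ∈ ℂ⁺ for every x ∈ (0,+∞). Then ρ is absolutely continuous with respect to Lebesgue measure, and there exists an open set U ⊆ ℝ with ρ(U) = 1 such that ρ admits a density that is real-analytic on U. -/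

import Mathlib

open MeasureTheory Complex Set Filter Topology

noncomputable section

/-- The upper half-plane. -/
def UHP : Set ℂ := {z : ℂ | 0 < z.im}

/-- The nonnegative real axis, viewed as a subset of `ℂ`. -/
def posAxis : Set ℂ := {z : ℂ | z.im = 0 ∧ 0 ≤ z.re}

/-- `M_μ(z) = ∫ z t² / (1 - z t²) dμ(t)`. -/
def Mt (μ : Measure ℝ) (z : ℂ) : ℂ := ∫ t : ℝ, z * (t : ℂ) ^ 2 / (1 - z * (t : ℂ) ^ 2) ∂μ

/-- `H_μ(z) = z (1 + M_μ(z)) (1 + λ M_μ(z))`. -/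
def Ht (l : ℝ) (μ : Measure ℝ) (z : ℂ) : ℂ :=
  z * (1 + Mt μ z) * (1 + (l : ℂ) * Mt μ z)

/-- `T(w) = (λ w + 1)(w + 1)`. -/
def Tfun (l : ℝ) (w : ℂ) : ℂ := ((l : ℂ) * w + 1) * (w + 1)

/-- The rectangular `R`-transform with Lévy measure `G`:
`C(z) = z ∫ (1+t²)/(1-z t²) dG(t)`. -/
def rectC (G : Measure ℝ) (z : ℂ) : ℂ :=
  z * ∫ t : ℝ, (1 + (t : ℂ) ^ 2) / (1 - z * (t : ℂ) ^ 2) ∂G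

/-- `μ` is `⊞_λ`-infinitely divisible with rectangular `R`-transform `C = rectC G`:
`H_μ(x) = x T(C(H_μ(x)))` for `x < 0` close to `0`. -/
def IsRectInfDiv (l : ℝ) (μ G : Measure ℝ) : Prop :=
  ∃ ε > (0 : ℝ), ∀ x ∈ Set.Ioo (-ε) (0 : ℝ),
    Ht l μ (x : ℂ) = (x : ℂ) * Tfun l (rectC G (Ht l μ (x : ℂ)))

/-- `ρ` is the rectangular free convolution `μ ⊞_λ ν`, where `μ` has rectangular
`R`-transform `rectC G`. -/
def IsRectConv (l : ℝ) (G ν ρ : Measure ℝ) : Prop :=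
  ∃ ε > (0 : ℝ), ∀ x ∈ Set.Ioo (-ε) (0 : ℝ),
    Tfun l (Mt ρ (x : ℂ) - rectC G (Ht l ρ (x : ℂ))) ≠ 0 ∧
    Ht l ρ (x : ℂ) =
      Ht l ν (Ht l ρ (x : ℂ) / Tfun l (Mt ρ (x : ℂ) - rectC G (Ht l ρ (x : ℂ))))

section

/-- The slit plane `ℂ ∖ [0,∞)`. -/
def slit : Set ℂ := {z | z.re < ‖z‖}

lemma isOpen_slit : IsOpen slit := isOpen_lt Complex.continuous_re continuous_norm

lemma mem_slit_of_im {z : ℂ} (h : z.im ≠ 0) : z ∈ slit := by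
  have := Complex.abs_re_lt_norm.2 h
  exact (le_abs_self _).trans_lt this

lemma mem_slit_of_neg {x : ℝ} (h : x < 0) : (x : ℂ) ∈ slit := by
  simp only [slit, Set.mem_ofPred_eq, Complex.ofReal_re, Complex.norm_real, Real.norm_eq_abs]
  exact h.trans (abs_pos.2 h.ne)

lemma slit_normSq (z : ℂ) (s : ℝ) :
    ‖1 - z * s‖ ^ 2 = (1 + s * ‖z‖) ^ 2 - 2 * s * (‖z‖ + z.re) := by
  have h := Complex.sq_norm z
  rw [Complex.normSq_apply] at h
  rw [Complex.sq_norm, Complex.normSq_apply]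
  simp
  linear_combination (-s ^ 2) * h

lemma slit_bound {z : ℂ} (hz : z ∈ slit) :
    ∃ κ > (0 : ℝ), ∀ s : ℝ, 0 ≤ s → κ * (1 + s) ≤ ‖1 - z * s‖ := by
  have hz' : z.re < ‖z‖ := hz
  have hr : 0 < ‖z‖ := by
    rcases eq_or_ne z 0 with rfl | h
    · simp at hz'
    · exact norm_pos_iff.2 h
  set r := ‖z‖ with hrdef
  set d : ℝ := (r - z.re) / (2 * r) with hd
  have hdpos : 0 < d := by apply div_pos <;> linarith
  refine ⟨Real.sqrt d * min 1 r, by positivity, fun s hs => ?_⟩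
  have h1 : (Real.sqrt d * (1 + s * r)) ^ 2 ≤ ‖1 - z * s‖ ^ 2 := by
    rw [slit_normSq, mul_pow, Real.sq_sqrt hdpos.le]
    have h2 : r + z.re = 2 * r * (1 - d) := by rw [hd]; field_simp; ring
    have h3 : 0 ≤ 1 - d := by
      have : 0 ≤ 2 * r * (1 - d) := by
        rw [← h2]; have := Complex.abs_re_le_norm z; have := neg_abs_le z.re; linarith
      by_contra hc
      push Not at hc
      nlinarith
    rw [← hrdef, h2]
    nlinarith [mul_nonneg h3 (sq_nonneg (1 - s * r))]
  have h4 : Real.sqrt d * (1 + s * r) ≤ ‖1 - z * s‖ :=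
    le_of_sq_le_sq h1 (norm_nonneg _)
  refine le_trans ?_ h4
  rw [mul_assoc]
  apply mul_le_mul_of_nonneg_left _ (Real.sqrt_nonneg d)
  have := min_le_left 1 r
  have := min_le_right 1 r
  nlinarith

lemma slit_bound_nhds {z : ℂ} (hz : z ∈ slit) :
    ∃ κ > (0 : ℝ), ∀ z' ∈ Metric.ball z κ, ∀ s : ℝ, 0 ≤ s → κ * (1 + s) ≤ ‖1 - z' * s‖ := by
  obtain ⟨κ, hκ, h⟩ := slit_bound hz
  refine ⟨κ / 2, by positivity, fun z' hz' s hs => ?_⟩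
  have h1 := h s hs
  have h2 : ‖1 - z * s‖ ≤ ‖1 - z' * s‖ + ‖(z' - z) * s‖ := by
    have : 1 - z * s = (1 - z' * s) + (z' - z) * s := by ring
    rw [this]; exact norm_add_le _ _
  have h3 : ‖(z' - z) * s‖ ≤ κ / 2 * s := by
    rw [norm_mul, Complex.norm_real, Real.norm_eq_abs, abs_of_nonneg hs]
    apply mul_le_mul_of_nonneg_right _ hs
    rw [Metric.mem_ball, dist_eq_norm] at hz'
    exact hz'.le
  nlinarith

/-- The common integral transform. -/
def Jt (m : Measure ℝ) (α β : ℝ) (z : ℂ) : ℂ :=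
  ∫ t : ℝ, ((α : ℂ) + β * (t : ℂ) ^ 2) / (1 - z * (t : ℂ) ^ 2) ∂m

lemma kern_bound {κ α β : ℝ} (hκ : 0 < κ) {z : ℂ} {t : ℝ} (h : κ * (1 + t ^ 2) ≤ ‖1 - z * (t : ℂ) ^ 2‖) :
    ‖((α : ℂ) + β * (t : ℂ) ^ 2) / (1 - z * (t : ℂ) ^ 2)‖ ≤ (|α| + |β|) / κ := by
  have hp : 0 < κ * (1 + t ^ 2) := by positivity
  rw [norm_div, div_le_div_iff₀ (hp.trans_le h) hκ]
  have h1 : ‖(α : ℂ) + β * (t : ℂ) ^ 2‖ ≤ |α| + |β| * t ^ 2 := by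
    refine (norm_add_le _ _).trans ?_
    simp
  have h2 : |α| + |β| * t ^ 2 ≤ (|α| + |β|) * (1 + t ^ 2) := by
    nlinarith [mul_nonneg (abs_nonneg α) (sq_nonneg t), abs_nonneg β]
  calc _ ≤ ((|α| + |β|) * (1 + t ^ 2)) * κ := by
        apply mul_le_mul_of_nonneg_right (h1.trans h2) hκ.le
    _ = (|α| + |β|) * (κ * (1 + t ^ 2)) := by ring
    _ ≤ _ := by apply mul_le_mul_of_nonneg_left h (by positivity)

lemma kern_meas (α β : ℝ) (z : ℂ) (m : Measure ℝ) :
    AEStronglyMeasurable (fun t : ℝ => ((α : ℂ) + β * (t : ℂ) ^ 2) / (1 - z * (t : ℂ) ^ 2)) m := by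
  apply Measurable.aestronglyMeasurable
  fun_prop

lemma kern_integrable (m : Measure ℝ) [IsFiniteMeasure m] (α β : ℝ) {z : ℂ} (hz : z ∈ slit) :
    Integrable (fun t : ℝ => ((α : ℂ) + β * (t : ℂ) ^ 2) / (1 - z * (t : ℂ) ^ 2)) m := by
  obtain ⟨κ, hκ, h⟩ := slit_bound hz
  refine Integrable.of_bound (kern_meas α β z m) ((|α| + |β|) / κ) (Eventually.of_forall fun t => ?_)
  apply kern_bound hκ
  have := h (t ^ 2) (sq_nonneg t)
  push_cast at this
  exact this

lemma Jt_diff (m : Measure ℝ) [IsFiniteMeasure m] (α β : ℝ) {z : ℂ} (hz : z ∈ slit) :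
    DifferentiableAt ℂ (Jt m α β) z := by
  obtain ⟨κ, hκ, h⟩ := slit_bound_nhds hz
  have key := hasDerivAt_integral_of_dominated_loc_of_deriv_le (μ := m) (𝕜 := ℂ)
    (F := fun z (t : ℝ) => ((α : ℂ) + β * (t : ℂ) ^ 2) / (1 - z * (t : ℂ) ^ 2))
    (F' := fun z (t : ℝ) => ((α : ℂ) + β * (t : ℂ) ^ 2) * (t : ℂ) ^ 2 / (1 - z * (t : ℂ) ^ 2) ^ 2)
    (x₀ := z) (s := Metric.ball z κ) (bound := fun _ => (|α| + |β|) / κ * ((|0| + |1|) / κ))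
    (Metric.ball_mem_nhds z hκ) (Eventually.of_forall fun w => kern_meas α β w m)
    (kern_integrable m α β hz) (by
      apply Measurable.aestronglyMeasurable
      fun_prop) ?_ (integrable_const _) ?_
  · exact key.2.differentiableAt
  · refine Eventually.of_forall fun t w hw => ?_
    have h1 := h w hw (t ^ 2) (sq_nonneg t)
    push_cast at h1
    have h2 := kern_bound (α := α) (β := β) hκ h1
    have h3 := kern_bound (α := 0) (β := 1) hκ h1
    have : ((α : ℂ) + β * (t : ℂ) ^ 2) * (t : ℂ) ^ 2 / (1 - w * (t : ℂ) ^ 2) ^ 2 =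
       (((α : ℂ) + β * (t : ℂ) ^ 2) / (1 - w * (t : ℂ) ^ 2)) *
        ((((0 : ℝ) : ℂ) + (1 : ℝ) * (t : ℂ) ^ 2) / (1 - w * (t : ℂ) ^ 2)) := by
      rw [div_mul_div_comm]; simp [sq]
    rw [this, norm_mul]
    apply mul_le_mul h2 h3 (norm_nonneg _)
    positivity
  · refine Eventually.of_forall fun t w hw => ?_
    have h1 := h w hw (t ^ 2) (sq_nonneg t)
    push_cast at h1
    have hne : 1 - w * (t : ℂ) ^ 2 ≠ 0 := by
      rw [← norm_pos_iff]
      exact lt_of_lt_of_le (by positivity) h1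
    have hd : HasDerivAt (fun w : ℂ => 1 - w * (t : ℂ) ^ 2) (-(t : ℂ) ^ 2) w := by
      have := ((hasDerivAt_id w).mul_const ((t : ℂ) ^ 2)).const_sub 1
      simpa using this
    have := (hasDerivAt_const w ((α : ℂ) + β * (t : ℂ) ^ 2)).div hd hne
    exact this.congr_deriv (by ring)

lemma Mt_eq (m : Measure ℝ) (z : ℂ) : Mt m z = z * Jt m 0 1 z := by
  unfold Mt Jt
  rw [← integral_const_mul]
  congr 1; ext t
  simp; ring

lemma rectC_eq (m : Measure ℝ) (z : ℂ) : rectC m z = z * Jt m 1 1 z := by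
  unfold rectC Jt
  simp

lemma one_add_Mt_eq (m : Measure ℝ) [IsProbabilityMeasure m] {z : ℂ} (hz : z ∈ slit) :
    1 + Mt m z = Jt m 1 0 z := by
  have : (1 : ℂ) = ∫ t : ℝ, (1 : ℂ) ∂m := by simp
  rw [Mt_eq, this]
  unfold Jt
  rw [← integral_const_mul, ← integral_add (integrable_const _)
    ((kern_integrable m 0 1 hz).const_mul z)]
  obtain ⟨κ, hκ, h⟩ := slit_bound hz
  congr 1; ext t
  have h1 := h (t ^ 2) (sq_nonneg t)
  push_cast at h1
  have hne : 1 - z * (t : ℂ) ^ 2 ≠ 0 := by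
    rw [← norm_pos_iff]
    exact lt_of_lt_of_le (by positivity) h1
  field_simp
  simp

lemma Mt_diff (m : Measure ℝ) [IsFiniteMeasure m] {z : ℂ} (hz : z ∈ slit) :
    DifferentiableAt ℂ (Mt m) z := by
  have : Mt m = fun z => z * Jt m 0 1 z := funext (Mt_eq m)
  rw [this]
  exact differentiableAt_id.mul (Jt_diff m 0 1 hz)

lemma rectC_diff (m : Measure ℝ) [IsFiniteMeasure m] {z : ℂ} (hz : z ∈ slit) :
    DifferentiableAt ℂ (rectC m) z := by
  have : rectC m = fun z => z * Jt m 1 1 z := funext (rectC_eq m)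
  rw [this]
  exact differentiableAt_id.mul (Jt_diff m 1 1 hz)

lemma Ht_diff (l : ℝ) (m : Measure ℝ) [IsFiniteMeasure m] {z : ℂ} (hz : z ∈ slit) :
    DifferentiableAt ℂ (Ht l m) z := by
  have h := Mt_diff m hz
  unfold Ht
  fun_prop

lemma analyticAt_slit {f : ℂ → ℂ} (hf : ∀ z ∈ slit, DifferentiableAt ℂ f z) {z : ℂ} (hz : z ∈ slit) :
    AnalyticAt ℂ f z := by
  have : DifferentiableOn ℂ f slit := fun z hz => (hf z hz).differentiableWithinAt
  exact this.analyticAt (isOpen_slit.mem_nhds hz)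

lemma Mt_an (m : Measure ℝ) [IsFiniteMeasure m] {z : ℂ} (hz : z ∈ slit) :
    AnalyticAt ℂ (Mt m) z := analyticAt_slit (fun _ h => Mt_diff m h) hz

lemma rectC_an (m : Measure ℝ) [IsFiniteMeasure m] {z : ℂ} (hz : z ∈ slit) :
    AnalyticAt ℂ (rectC m) z := analyticAt_slit (fun _ h => rectC_diff m h) hz

lemma Ht_an (l : ℝ) (m : Measure ℝ) [IsFiniteMeasure m] {z : ℂ} (hz : z ∈ slit) :
    AnalyticAt ℂ (Ht l m) z := analyticAt_slit (fun _ h => Ht_diff l m h) hz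

lemma Tfun_an (l : ℝ) (z : ℂ) : AnalyticAt ℂ (Tfun l) z := by
  unfold Tfun; fun_prop

lemma Ht_eq (l : ℝ) (m : Measure ℝ) (z : ℂ) : Ht l m z = z * Tfun l (Mt m z) := by
  unfold Ht Tfun; ring
end

section

lemma slit_ne {z : ℂ} (hz : z ∈ slit) (t : ℝ) : 1 - z * (t : ℂ) ^ 2 ≠ 0 := by
  obtain ⟨κ, hκ, h⟩ := slit_bound hz
  have h1 := h (t ^ 2) (sq_nonneg t)
  push_cast at h1
  rw [← norm_pos_iff]
  exact lt_of_lt_of_le (by positivity) h1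

lemma rkern_integrable (m : Measure ℝ) [IsFiniteMeasure m] (α β γ δ : ℝ) {z : ℂ} (hz : z ∈ slit) :
    Integrable (fun t : ℝ => (α + β * t ^ 2) * (γ + δ * t ^ 2) / ‖1 - z * (t : ℂ) ^ 2‖ ^ 2) m := by
  obtain ⟨κ, hκ, h⟩ := slit_bound hz
  refine Integrable.of_bound (by
    apply Measurable.aestronglyMeasurable
    fun_prop) (((|α| + |β|) / κ) * ((|γ| + |δ|) / κ)) (Eventually.of_forall fun t => ?_)
  have h1 := h (t ^ 2) (sq_nonneg t)
  push_cast at h1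
  have h2 := kern_bound (α := α) (β := β) hκ h1
  have h3 := kern_bound (α := γ) (β := δ) hκ h1
  have h4 := mul_le_mul h2 h3 (norm_nonneg _) (by positivity)
  refine le_trans (le_of_eq ?_) h4
  rw [← norm_mul, div_mul_div_comm, norm_div, norm_div, ← sq (1 - z * (t : ℂ) ^ 2), norm_pow, norm_pow,
    norm_norm]
  congr 1
  rw [← Complex.norm_real]
  push_cast
  rfl

lemma Jt_decomp (m : Measure ℝ) [IsFiniteMeasure m] (α β : ℝ) {z : ℂ} (hz : z ∈ slit) :
    Jt m α β z = ((∫ t : ℝ, (α + β * t ^ 2) * (1 + 0 * t ^ 2) / ‖1 - z * (t : ℂ) ^ 2‖ ^ 2 ∂m : ℝ) : ℂ) -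
      (starRingEnd ℂ z) *
      ((∫ t : ℝ, (α + β * t ^ 2) * (0 + 1 * t ^ 2) / ‖1 - z * (t : ℂ) ^ 2‖ ^ 2 ∂m : ℝ) : ℂ) := by
  rw [← integral_complex_ofReal, ← integral_complex_ofReal, ← integral_const_mul, ← integral_sub]
  · unfold Jt
    congr 1; ext t
    have hne := slit_ne hz t
    have hn : (((‖1 - z * (t : ℂ) ^ 2‖ ^ 2 : ℝ)) : ℂ) =
        (1 - z * (t : ℂ) ^ 2) * (1 - (starRingEnd ℂ z) * (t : ℂ) ^ 2) := by
      have := Complex.mul_conj (1 - z * (t : ℂ) ^ 2)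
      rw [Complex.sq_norm, ← this]
      simp
    have hne2 : (1 - (starRingEnd ℂ z) * (t : ℂ) ^ 2) ≠ 0 := by
      intro h0
      have : (((‖1 - z * (t : ℂ) ^ 2‖ ^ 2 : ℝ)) : ℂ) = 0 := by rw [hn, h0, mul_zero]
      have h2 : ‖1 - z * (t : ℂ) ^ 2‖ ^ 2 = 0 := by exact_mod_cast this
      exact hne (norm_eq_zero.1 (pow_eq_zero_iff (two_ne_zero) |>.1 h2))
    rw [Complex.ofReal_div, Complex.ofReal_div, hn]
    push_cast
    generalize (starRingEnd ℂ) z = w at hne2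
    generalize hA : 1 - z * (t : ℂ) ^ 2 = A at hne
    have hB : 1 - w * (t : ℂ) ^ 2 ≠ 0 := hne2
    generalize hB' : 1 - w * (t : ℂ) ^ 2 = B at hB
    have hw : w * (t : ℂ) ^ 2 = 1 - B := by rw [← hB']; ring
    have e : w * (((α : ℂ) + β * (t : ℂ) ^ 2) * (0 + 1 * (t : ℂ) ^ 2) / (A * B)) =
      ((α : ℂ) + β * (t : ℂ) ^ 2) * (w * (t : ℂ) ^ 2) / (A * B) := by ring
    rw [e, hw]
    field_simp
    ring
  · exact (rkern_integrable m α β 1 0 hz).ofReal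
  · exact ((rkern_integrable m α β 0 1 hz).ofReal).const_mul _

lemma int_pos (m : Measure ℝ) (f : ℝ → ℝ) (hf : ∀ t, 0 ≤ f t) (hi : Integrable f m)
    (hs : m (Function.support f) ≠ 0) : 0 < ∫ t, f t ∂m :=
  (integral_pos_iff_support_of_nonneg hf hi).2 (pos_iff_ne_zero.2 hs)

lemma mul_conj_norm (z : ℂ) : z * (starRingEnd ℂ z) = ((‖z‖ ^ 2 : ℝ) : ℂ) := by
  rw [Complex.mul_conj, Complex.sq_norm]

lemma zJt_decomp (m : Measure ℝ) [IsFiniteMeasure m] (α β : ℝ) {z : ℂ} (hz : z ∈ slit) :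
    z * Jt m α β z =
      ((∫ t : ℝ, (α + β * t ^ 2) * (1 + 0 * t ^ 2) / ‖1 - z * (t : ℂ) ^ 2‖ ^ 2 ∂m : ℝ) : ℂ) * z -
      ((‖z‖ ^ 2 *
        (∫ t : ℝ, (α + β * t ^ 2) * (0 + 1 * t ^ 2) / ‖1 - z * (t : ℂ) ^ 2‖ ^ 2 ∂m) : ℝ) : ℂ) := by
  rw [Jt_decomp m α β hz, mul_sub, ← mul_assoc, mul_conj_norm]
  push_cast
  ring

lemma zJt_im (m : Measure ℝ) [IsFiniteMeasure m] (α β : ℝ) {z : ℂ} (hz : z ∈ slit) :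
    (z * Jt m α β z).im =
      (∫ t : ℝ, (α + β * t ^ 2) * (1 + 0 * t ^ 2) / ‖1 - z * (t : ℂ) ^ 2‖ ^ 2 ∂m) * z.im := by
  rw [zJt_decomp m α β hz, Complex.sub_im, Complex.ofReal_im, Complex.im_ofReal_mul, sub_zero]

lemma Mt_im_nonneg (m : Measure ℝ) [IsFiniteMeasure m] {z : ℂ} (hz : 0 < z.im) : 0 ≤ (Mt m z).im := by
  rw [Mt_eq, zJt_im m 0 1 (mem_slit_of_im hz.ne')]
  apply mul_nonneg _ hz.le
  apply integral_nonneg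
  intro t
  simp only [Pi.zero_apply]
  positivity

lemma Mt_im_pos (m : Measure ℝ) [IsProbabilityMeasure m] (hm : m {0} = 0) {z : ℂ} (hz : 0 < z.im) :
    0 < (Mt m z).im := by
  have hs := mem_slit_of_im hz.ne'
  rw [Mt_eq, zJt_im m 0 1 hs]
  apply mul_pos _ hz
  apply int_pos
  · intro t; positivity
  · exact rkern_integrable m 0 1 1 0 hs
  · intro h0
    have h1 : m ({0}ᶜ) = 0 := by
      refine measure_mono_null ?_ h0
      intro t ht
      have hne := norm_pos_iff.2 (slit_ne hs t)
      have ht' : t ≠ 0 := ht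
      simp only [Function.mem_support]
      positivity
    have h2 : m univ = 0 := by
      rw [← union_compl_self ({0} : Set ℝ)]
      exact measure_union_null hm h1
    simp at h2

lemma z_one_add_Mt_im (m : Measure ℝ) [IsProbabilityMeasure m] {z : ℂ} (hz : 0 < z.im) :
    0 < (z * (1 + Mt m z)).im := by
  have hs := mem_slit_of_im hz.ne'
  rw [one_add_Mt_eq m hs, zJt_im m 1 0 hs]
  apply mul_pos _ hz
  apply int_pos
  · intro t; positivity
  · exact rkern_integrable m 1 0 1 0 hs
  · have : Function.support (fun t : ℝ => ((1 : ℝ) + 0 * t ^ 2) * (1 + 0 * t ^ 2) / ‖1 - z * (t : ℂ) ^ 2‖ ^ 2) = univ := by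
      ext t
      have hne := norm_pos_iff.2 (slit_ne hs t)
      simp only [Function.mem_support, mem_univ, iff_true]
      positivity
    rw [this]; simp

/-- the centre of symmetry of `T`. -/
def ac (l : ℝ) : ℂ := ((1 + l) / (2 * l) : ℝ)

lemma ac_im (l : ℝ) : (ac l).im = 0 := Complex.ofReal_im _

lemma inv_im_nonpos {w : ℂ} (h : 0 ≤ w.im) : (w⁻¹).im ≤ 0 := by
  rw [Complex.inv_im]
  apply div_nonpos_of_nonpos_of_nonneg (by linarith) (Complex.normSq_nonneg _)

lemma Ht_facts {l : ℝ} (hl : l ∈ Set.Ioo (0 : ℝ) 1) (m : Measure ℝ) [IsProbabilityMeasure m] {z : ℂ}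
    (hz : 0 < z.im) : Ht l m z ≠ 0 ∧ ((Mt m z + ac l) / Ht l m z).im ≤ 0 := by
  obtain ⟨hl0, hl1⟩ := hl
  have h1 := z_one_add_Mt_im m hz
  set M := Mt m z with hM
  have h2 : 0 < (z * (M + ((1 / l : ℝ) : ℂ))).im := by
    have : z * (M + ((1 / l : ℝ) : ℂ)) = z * (1 + M) + ((1 / l - 1 : ℝ) : ℂ) * z := by push_cast; ring
    rw [this, Complex.add_im, Complex.im_ofReal_mul]
    have : 0 < 1 / l - 1 := by
      rw [sub_pos, lt_div_iff₀ hl0]; linarith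
    positivity
  have hn1 : z * (1 + M) ≠ 0 := by intro h; rw [h] at h1; simp at h1
  have hn2 : z * (M + ((1 / l : ℝ) : ℂ)) ≠ 0 := by intro h; rw [h] at h2; simp at h2
  have hz0 := left_ne_zero_of_mul hn1
  have hM1 := right_ne_zero_of_mul hn1
  have hM2 := right_ne_zero_of_mul hn2
  have hlC : (l : ℂ) ≠ 0 := by exact_mod_cast hl0.ne'
  have hH : Ht l m z = l * (z * ((1 + M) * (M + ((1 / l : ℝ) : ℂ)))) := by
    unfold Ht
    rw [← hM]
    push_cast
    field_simp
    ring
  have hne : Ht l m z ≠ 0 := by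
    rw [hH]
    exact mul_ne_zero hlC (mul_ne_zero hz0 (mul_ne_zero hM1 hM2))
  refine ⟨hne, ?_⟩
  have key : (M + ac l) / Ht l m z = ((1 / (2 * l) : ℝ) : ℂ) * ((z * (1 + M))⁻¹ + (z * (M + ((1 / l : ℝ) : ℂ)))⁻¹) := by
    rw [hH]
    generalize hb : ((1 / l : ℝ) : ℂ) = b at *
    have hb' : b * l = 1 := by rw [← hb]; push_cast; field_simp
    have hac : ac l = (1 + b) / 2 := by
      rw [← hb]; unfold ac; push_cast; field_simp; ring
    rw [hac]; push_cast; field_simp; ring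
  rw [key, Complex.im_ofReal_mul, Complex.add_im]
  apply mul_nonpos_of_nonneg_of_nonpos (by positivity)
  have := inv_im_nonpos h1.le
  have := inv_im_nonpos h2.le
  linarith

lemma mem_slit_alg {l : ℝ} {M h : ℂ} (hne : h ≠ 0) (hM : 0 < M.im) (hP : ((M + ac l) / h).im ≤ 0) :
    h ∈ slit := by
  by_contra hc
  simp only [slit, Set.mem_ofPred_eq, not_lt] at hc
  have h1 : h.re = ‖h‖ := le_antisymm (Complex.re_le_norm h) hc
  have him : h.im = 0 := by
    by_contra hi
    have := mem_slit_of_im hi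
    simp only [slit, Set.mem_ofPred_eq] at this
    linarith
  have hh : h = ((‖h‖ : ℝ) : ℂ) := by
    apply Complex.ext <;> simp [h1, him]
  rw [hh, Complex.div_ofReal_im] at hP
  have : (M + ac l).im = M.im := by simp [ac_im]
  rw [this] at hP
  have := div_pos hM (norm_pos_iff.2 hne)
  linarith

lemma T_sub {l : ℝ} (hl : 0 < l) (M m : ℂ) :
    Tfun l M - Tfun l m = l * (M - m) * ((M + ac l) + (m + ac l)) := by
  have hlC : (l : ℂ) ≠ 0 := by exact_mod_cast hl.ne'
  unfold Tfun ac
  push_cast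
  field_simp
  ring

lemma alg {l : ℝ} (hl : 0 < l) {z M h C : ℂ} {p q : ℝ} (hp : 0 < p) (hq : 0 ≤ q)
    (hC : C = p * h - q) (hh : h = z * Tfun l M) (hne : h ≠ 0) (hz : 0 ≤ z.im) (hM : 0 < M.im)
    (hP : ((M + ac l) / h).im ≤ 0) (hQ : 0 ≤ (M - C).im) (hQ' : ((M - C + ac l) / h).im ≤ 0) :
    Tfun l (M - C) ≠ 0 ∧ 0 < (h / Tfun l (M - C)).im := by
  have hz0 : z ≠ 0 := by intro h0; rw [h0, zero_mul] at hh; exact hne hh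
  have hT0 : Tfun l M ≠ 0 := by intro h0; rw [h0, mul_zero] at hh; exact hne hh
  set S := (M + ac l) + (M - C + ac l) with hS
  have h1 : Tfun l (M - C) / h = z⁻¹ - l * (p * S - q * (S / h)) := by
    have h2 := T_sub hl M (M - C)
    rw [← hS] at h2
    have h3 : Tfun l (M - C) = Tfun l M - l * C * S := by
      rw [sub_sub_cancel] at h2
      rw [← h2]; ring
    rw [h3, sub_div]
    congr 1
    · rw [hh]; field_simp
    · rw [hC]; field_simp
  have hSim : 0 < S.im := by
    have : S.im = M.im + (M - C).im := by simp [hS, ac_im]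
    rw [this]; linarith
  have hSh : (S / h).im ≤ 0 := by
    rw [hS, add_div, Complex.add_im]; linarith
  have h4 : (Tfun l (M - C) / h).im < 0 := by
    rw [h1, Complex.sub_im, Complex.im_ofReal_mul, Complex.sub_im, Complex.im_ofReal_mul,
      Complex.im_ofReal_mul]
    have := inv_im_nonpos hz
    have : 0 < l * (p * S.im - q * (S / h).im) := by
      apply mul_pos hl
      have := mul_pos hp hSim
      have := mul_nonneg hq (neg_nonneg.2 hSh)
      linarith
    linarith
  have h5 : Tfun l (M - C) ≠ 0 := by intro h0; rw [h0] at h4; simp at h4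
  refine ⟨h5, ?_⟩
  rw [← inv_div, Complex.inv_im]
  apply div_pos (by linarith)
  rw [Complex.normSq_pos]
  exact div_ne_zero h5 hne

lemma C_decomp (G : Measure ℝ) [IsFiniteMeasure G] (hG : G ≠ 0) {h : ℂ} (hh : h ∈ slit) :
    ∃ p q : ℝ, 0 < p ∧ 0 ≤ q ∧ rectC G h = p * h - q ∧
      ‖rectC G ((-‖h‖ : ℝ) : ℂ)‖ ≤ p * ‖h‖ + q := by
  have hp : 0 < ∫ t : ℝ, (1 + 1 * t ^ 2) * (1 + 0 * t ^ 2) / ‖1 - h * (t : ℂ) ^ 2‖ ^ 2 ∂G := by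
    apply int_pos
    · intro t; positivity
    · exact rkern_integrable G 1 1 1 0 hh
    · have : Function.support (fun t : ℝ => ((1 : ℝ) + 1 * t ^ 2) * (1 + 0 * t ^ 2) / ‖1 - h * (t : ℂ) ^ 2‖ ^ 2) = univ := by
        ext t
        have hne := norm_pos_iff.2 (slit_ne hh t)
        simp only [Function.mem_support, mem_univ, iff_true]
        positivity
      rw [this]
      simpa using hG
  have hq : 0 ≤ ∫ t : ℝ, (1 + 1 * t ^ 2) * (0 + 1 * t ^ 2) / ‖1 - h * (t : ℂ) ^ 2‖ ^ 2 ∂G := by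
    apply integral_nonneg
    intro t
    simp only [Pi.zero_apply]
    positivity
  refine ⟨_, _, hp, mul_nonneg (sq_nonneg ‖h‖) hq, ?_, ?_⟩
  · rw [rectC_eq, zJt_decomp G 1 1 hh]
  · have hr : 0 < ‖h‖ := by
      rcases eq_or_ne h 0 with rfl | h0
      · simp [slit] at hh
      · exact norm_pos_iff.2 h0
    rw [mul_comm _ ‖h‖, ← integral_const_mul, ← integral_const_mul, ← integral_add
      ((rkern_integrable G 1 1 1 0 hh).const_mul _) ((rkern_integrable G 1 1 0 1 hh).const_mul _)]
    unfold rectC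
    rw [← integral_const_mul]
    refine norm_integral_le_of_norm_le (((rkern_integrable G 1 1 1 0 hh).const_mul _).add
       ((rkern_integrable G 1 1 0 1 hh).const_mul _)) (Eventually.of_forall fun t => ?_)
    have hne := norm_pos_iff.2 (slit_ne hh t)
    have hle : ‖1 - h * (t : ℂ) ^ 2‖ ≤ 1 + ‖h‖ * t ^ 2 := by
      refine (norm_sub_le _ _).trans ?_
      simp
    have e : ((-‖h‖ : ℝ) : ℂ) * ((1 + (t : ℂ) ^ 2) / (1 - ((-‖h‖ : ℝ) : ℂ) * (t : ℂ) ^ 2)) =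
        ((-(‖h‖ * (1 + t ^ 2) / (1 + ‖h‖ * t ^ 2)) : ℝ) : ℂ) := by
      push_cast
      rw [neg_mul, neg_mul, sub_neg_eq_add, mul_div_assoc]
    rw [e, Complex.norm_real, norm_neg, Real.norm_eq_abs, abs_of_nonneg (by positivity)]
    have e2 : ‖h‖ * ((1 + 1 * t ^ 2) * (1 + 0 * t ^ 2) / ‖1 - h * (t : ℂ) ^ 2‖ ^ 2) + ‖h‖ ^ 2 *
      ((1 + 1 * t ^ 2) * (0 + 1 * t ^ 2) / ‖1 - h * (t : ℂ) ^ 2‖ ^ 2) =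
       ‖h‖ * (1 + t ^ 2) * (1 + ‖h‖ * t ^ 2) / ‖1 - h * (t : ℂ) ^ 2‖ ^ 2 := by
      field_simp
      ring
    rw [e2, div_le_div_iff₀ (by positivity) (by positivity), mul_assoc]
    have := pow_le_pow_left₀ hne.le hle 2
    have h6 : 0 ≤ ‖h‖ * (1 + t ^ 2) := by positivity
    nlinarith [mul_le_mul_of_nonneg_left this h6]
end

section

/-- standing assumptions. -/
structure SubS (l : ℝ) (G ν ρ : Measure ℝ) : Prop where
  hl : l ∈ Set.Ioo (0 : ℝ) 1
  hG : G ≠ 0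
  conv : IsRectConv l G ν ρ
  grow : ∃ c > (0 : ℝ), ∃ R0 > (0 : ℝ), ∀ R : ℝ, R0 ≤ R → c * R ≤ ‖rectC G ((-R : ℝ) : ℂ)‖ ^ 2

lemma SubS.mk' (l : ℝ) (G ν ρ : Measure ℝ) (hl : l ∈ Set.Ioo (0 : ℝ) 1) (conv : IsRectConv l G ν ρ)
    (hC2 : ∃ L : EReal, L ≤ 0 ∧ L ≠ 0 ∧
      Tendsto (fun x : ℝ => (((rectC G (x : ℂ)) ^ 2 / (x : ℂ)).re : EReal)) atBot
        (nhds L)) : SubS l G ν ρ := by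
  obtain ⟨L, hL0, hL1, hL⟩ := hC2
  have hlt : L < 0 := lt_of_le_of_ne hL0 hL1
  refine ⟨hl, ?_, conv, ?_⟩
  · rintro rfl
    have : (fun x : ℝ => (((rectC (0 : Measure ℝ) (x : ℂ)) ^ 2 / (x : ℂ)).re : EReal)) = fun _ => 0 := by
      ext x; simp [rectC]
    rw [this] at hL
    exact hL1 (tendsto_nhds_unique hL tendsto_const_nhds)
  · obtain ⟨y, hy1, hy2⟩ := EReal.lt_iff_exists_real_btwn.1 hlt
    have hy0 : y < 0 := by exact_mod_cast hy2
    have h1 := (hL.eventually (gt_mem_nhds hy1))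
    obtain ⟨b, hb⟩ := (eventually_atBot.1 h1)
    refine ⟨-y, by linarith, max 1 (-b), by positivity, fun R hR => ?_⟩
    have hR1 : 1 ≤ R := (le_max_left _ _).trans hR
    have hRb : -R ≤ b := by have := (le_max_right 1 (-b)).trans hR; linarith
    have h2 := hb (-R) hRb
    have h3 : ((rectC G ((-R : ℝ) : ℂ)) ^ 2 / ((-R : ℝ) : ℂ)).re < y := by exact_mod_cast h2
    have h4 := Complex.abs_re_le_norm ((rectC G ((-R : ℝ) : ℂ)) ^ 2 / ((-R : ℝ) : ℂ))
    rw [norm_div, norm_pow, Complex.norm_real, Real.norm_eq_abs, abs_neg, abs_of_nonneg (by linarith : 0 ≤ R),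
      le_div_iff₀ (by linarith)] at h4
    have h5 := neg_abs_le ((rectC G ((-R : ℝ) : ℂ)) ^ 2 / ((-R : ℝ) : ℂ)).re
    nlinarith

/-- real version of `T`. -/
def Tr (l r : ℝ) : ℝ := (l * r + 1) * (r + 1)

lemma Tfun_real (l r : ℝ) : Tfun l (r : ℂ) = ((Tr l r : ℝ) : ℂ) := by
  unfold Tfun Tr; push_cast; rfl

lemma Tr_pos {l r : ℝ} (hl : l ∈ Set.Ioo (0 : ℝ) 1) (hr : -1 < r) : 0 < Tr l r := by
  obtain ⟨h0, h1⟩ := hl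
  apply mul_pos <;> nlinarith

lemma Tr_lt {l r s : ℝ} (hl : l ∈ Set.Ioo (0 : ℝ) 1) (hr : -1 < r) (hs : r < s) : Tr l r < Tr l s := by
  obtain ⟨h0, h1⟩ := hl
  unfold Tr
  have h2 : 0 < l * r + 1 := by nlinarith
  have h3 : l * r < l * s := by nlinarith
  nlinarith [mul_pos h2 (sub_pos.2 hs)]

lemma Tr_inj {l r s : ℝ} (hl : l ∈ Set.Ioo (0 : ℝ) 1) (hr : -1 < r) (hs : -1 < s) (h : Tr l r = Tr l s) :
    r = s := by
  rcases lt_trichotomy r s with h1 | h1 | h1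
  · exact absurd h (Tr_lt hl hr h1).ne
  · exact h1
  · exact absurd h (Tr_lt hl hs h1).ne'

lemma Mt_neg (m : Measure ℝ) [IsProbabilityMeasure m] {x : ℝ} (hx : x < 0) :
    ∃ r : ℝ, Mt m (x : ℂ) = r ∧ -1 < r ∧ r ≤ 0 ∧ m.real {0} ≤ 1 + r := by
  have hs := mem_slit_of_neg hx
  have hne := slit_ne hs
  have h1 := zJt_decomp m 0 1 hs
  have h2 := Jt_decomp m 1 0 hs
  rw [← Mt_eq] at h1
  rw [← one_add_Mt_eq m hs, Complex.conj_ofReal] at h2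
  have hP : 0 < ∫ t : ℝ, ((1 : ℝ) + 0 * t ^ 2) * (1 + 0 * t ^ 2) / ‖1 - (x : ℂ) * (t : ℂ) ^ 2‖ ^ 2 ∂m := by
    apply int_pos
    · intro t; positivity
    · exact rkern_integrable m 1 0 1 0 hs
    · have : Function.support (fun t : ℝ => ((1 : ℝ) + 0 * t ^ 2) * (1 + 0 * t ^ 2) / ‖1 - (x : ℂ) * (t : ℂ) ^ 2‖ ^ 2) = univ := by
        ext t
        have hne := norm_pos_iff.2 (slit_ne hs t)
        simp only [Function.mem_support, mem_univ, iff_true]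
        positivity
      rw [this]; simp
  have hP' : m.real {0} ≤ ∫ t : ℝ, ((1 : ℝ) + 0 * t ^ 2) * (1 + 0 * t ^ 2) / ‖1 - (x : ℂ) * (t : ℂ) ^ 2‖ ^ 2 ∂m := by
    have : m.real {0} = ∫ t : ℝ, ({0} : Set ℝ).indicator (fun _ => (1 : ℝ)) t ∂m := by
      rw [integral_indicator (measurableSet_singleton 0)]; simp [Measure.real]
    rw [this]
    apply integral_mono
    · exact (integrable_const _).indicator (measurableSet_singleton 0)
    · exact rkern_integrable m 1 0 1 0 hs
    · intro t
      by_cases ht : t = 0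
      · subst ht; simp
      · simp [ht]
  have hQ : 0 ≤ ∫ t : ℝ, ((1 : ℝ) + 0 * t ^ 2) * (0 + 1 * t ^ 2) / ‖1 - (x : ℂ) * (t : ℂ) ^ 2‖ ^ 2 ∂m := by
    apply integral_nonneg; intro t; simp only [Pi.zero_apply]; positivity
  have hA : 0 ≤ ∫ t : ℝ, ((0 : ℝ) + 1 * t ^ 2) * (1 + 0 * t ^ 2) / ‖1 - (x : ℂ) * (t : ℂ) ^ 2‖ ^ 2 ∂m := by
    apply integral_nonneg; intro t; simp only [Pi.zero_apply]; positivity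
  have hB : 0 ≤ ∫ t : ℝ, ((0 : ℝ) + 1 * t ^ 2) * (0 + 1 * t ^ 2) / ‖1 - (x : ℂ) * (t : ℂ) ^ 2‖ ^ 2 ∂m := by
    apply integral_nonneg; intro t; simp only [Pi.zero_apply]; positivity
  generalize (∫ t : ℝ, ((1 : ℝ) + 0 * t ^ 2) * (1 + 0 * t ^ 2) / ‖1 - (x : ℂ) * (t : ℂ) ^ 2‖ ^ 2 ∂m) = P at *
  generalize (∫ t : ℝ, ((1 : ℝ) + 0 * t ^ 2) * (0 + 1 * t ^ 2) / ‖1 - (x : ℂ) * (t : ℂ) ^ 2‖ ^ 2 ∂m) = Q at *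
  generalize (∫ t : ℝ, ((0 : ℝ) + 1 * t ^ 2) * (1 + 0 * t ^ 2) / ‖1 - (x : ℂ) * (t : ℂ) ^ 2‖ ^ 2 ∂m) = A at *
  generalize (∫ t : ℝ, ((0 : ℝ) + 1 * t ^ 2) * (0 + 1 * t ^ 2) / ‖1 - (x : ℂ) * (t : ℂ) ^ 2‖ ^ 2 ∂m) = B at *
  have e1 : Mt m (x : ℂ) = ((A * x - ‖(x : ℂ)‖ ^ 2 * B : ℝ) : ℂ) := by rw [h1]; push_cast; rfl
  have e2 : Mt m (x : ℂ) = ((P - x * Q - 1 : ℝ) : ℂ) := by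
    push_cast; linear_combination h2
  have e3 : A * x - ‖(x : ℂ)‖ ^ 2 * B = P - x * Q - 1 := by
    have := e1.symm.trans e2; exact_mod_cast this
  refine ⟨_, e1, ?_, ?_, ?_⟩
  · rw [e3]; nlinarith
  · have := mul_nonneg (sq_nonneg ‖(x : ℂ)‖) hB
    nlinarith
  · rw [e3]; nlinarith

lemma rectC_neg (G : Measure ℝ) [IsFiniteMeasure G] (hG : G ≠ 0) {x : ℝ} (hx : x < 0) :
    ∃ r : ℝ, rectC G (x : ℂ) = r ∧ r < 0 := by
  obtain ⟨p, q, hp, hq, h, -⟩ := C_decomp G hG (mem_slit_of_neg hx)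
  refine ⟨p * x - q, ?_, ?_⟩
  · rw [h]; push_cast; rfl
  · nlinarith

def mm (l : ℝ) (G ρ : Measure ℝ) (z : ℂ) : ℂ := Mt ρ z - rectC G (Ht l ρ z)
def om (l : ℝ) (G ρ : Measure ℝ) (z : ℂ) : ℂ := Ht l ρ z / Tfun l (mm l G ρ z)

lemma freq_of_real {x0 : ℝ} {P : ℂ → Prop} (h : ∀ᶠ x : ℝ in 𝓝 x0, P x) : ∃ᶠ z in 𝓝[≠] (x0 : ℂ), P z := by
  have h1 : Tendsto (fun x : ℝ => (x : ℂ)) (𝓝[≠] x0) (𝓝[≠] (x0 : ℂ)) := by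
    apply tendsto_nhdsWithin_of_tendsto_nhds_of_eventually_within
    · exact (Complex.continuous_ofReal.tendsto x0).mono_left nhdsWithin_le_nhds
    · filter_upwards [self_mem_nhdsWithin] with x hx
      simpa using hx
  apply h1.frequently
  exact (h.filter_mono nhdsWithin_le_nhds).frequently

variable {l : ℝ} {G ν ρ : Measure ℝ} [IsFiniteMeasure G] [IsProbabilityMeasure ν] [IsProbabilityMeasure ρ]

lemma neg_facts (S : SubS l G ν ρ) {x : ℝ} (hx : x < 0) :
    ∃ M h C w : ℝ, Mt ρ (x : ℂ) = M ∧ Ht l ρ (x : ℂ) = h ∧ rectC G (h : ℂ) = C ∧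
      mm l G ρ (x : ℂ) = ((M - C : ℝ) : ℂ) ∧ om l G ρ (x : ℂ) = w ∧ w * Tr l (M - C) = h ∧
      -1 < M ∧ M ≤ 0 ∧ ρ.real {0} ≤ 1 + M ∧ h < 0 ∧ C < 0 ∧ h = x * Tr l M ∧ w < 0 ∧ x ≤ w := by
  obtain ⟨M, hM, hM1, hM2, hM3⟩ := Mt_neg ρ hx
  have hT := Tr_pos S.hl hM1
  have hh : Ht l ρ (x : ℂ) = ((x * Tr l M : ℝ) : ℂ) := by
    rw [Ht_eq, hM, Tfun_real]; push_cast; rfl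
  have hneg : x * Tr l M < 0 := mul_neg_of_neg_of_pos hx hT
  obtain ⟨C, hC, hC0⟩ := rectC_neg G S.hG hneg
  have hm : mm l G ρ (x : ℂ) = ((M - C : ℝ) : ℂ) := by
    unfold mm; rw [hM, hh, hC]; push_cast; rfl
  have hT2 : Tr l M < Tr l (M - C) := Tr_lt S.hl hM1 (by linarith)
  have hT3 : 0 < Tr l (M - C) := hT.trans hT2
  refine ⟨M, x * Tr l M, C, x * Tr l M / Tr l (M - C), hM, hh, hC, hm, ?_, ?_, hM1, hM2, hM3, hneg, hC0, rfl,
    div_neg_of_neg_of_pos hneg hT3, ?_⟩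
  · unfold om; rw [hm, hh, Tfun_real]; push_cast; rfl
  · field_simp
  · rw [le_div_iff₀ hT3]; nlinarith

lemma om_an {z : ℂ} (hz : z ∈ slit) (hh : Ht l ρ z ∈ slit) (hT : Tfun l (mm l G ρ z) ≠ 0) :
    AnalyticAt ℂ (om l G ρ) z := by
  have h1 := Ht_an l ρ hz
  have h2 : AnalyticAt ℂ (fun z => rectC G (Ht l ρ z)) z := (rectC_an G hh).comp h1
  have h3 : AnalyticAt ℂ (mm l G ρ) z := (Mt_an ρ hz).sub h2
  have h4 : AnalyticAt ℂ (fun z => Tfun l (mm l G ρ z)) z := (Tfun_an l _).comp h3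
  exact h1.div h4 hT

lemma mm_an {z : ℂ} (hz : z ∈ slit) (hh : Ht l ρ z ∈ slit) :
    AnalyticAt ℂ (mm l G ρ) z := by
  have h1 := Ht_an l ρ hz
  have h2 : AnalyticAt ℂ (fun z => rectC G (Ht l ρ z)) z := (rectC_an G hh).comp h1
  exact (Mt_an ρ hz).sub h2

lemma neg_good (S : SubS l G ν ρ) {x : ℝ} (hx : x < 0) :
    Ht l ρ (x : ℂ) ∈ slit ∧ Tfun l (mm l G ρ (x : ℂ)) ≠ 0 ∧ om l G ρ (x : ℂ) ∈ slit := by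
  obtain ⟨M, h, C, w, h1, h2, h3, h4, h5, h6, h7, h8, h9, h10, h11, h12, h13, h14⟩ := neg_facts S hx
  refine ⟨?_, ?_, ?_⟩
  · rw [h2]; exact mem_slit_of_neg h10
  · rw [h4, Tfun_real]
    have := Tr_pos S.hl (show -1 < M - C by linarith)
    exact_mod_cast this.ne'
  · rw [h5]; exact mem_slit_of_neg h13

lemma neg_Ht (S : SubS l G ν ρ) {x : ℝ} (hx : x < 0) :
    Ht l ν (om l G ρ (x : ℂ)) = Ht l ρ (x : ℂ) := by
  obtain ⟨ε, hε, hc⟩ := S.conv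
  set U : Set ℂ := (fun x : ℝ => (x : ℂ)) '' Set.Iio 0
  have hU : IsPreconnected U := isPreconnected_Iio.image _ Complex.continuous_ofReal.continuousOn
  have hf : AnalyticOnNhd ℂ (fun z => Ht l ν (om l G ρ z)) U := by
    rintro _ ⟨y, hy, rfl⟩
    obtain ⟨g1, g2, g3⟩ := neg_good S (x := y) hy
    exact (Ht_an l ν g3).comp (om_an (mem_slit_of_neg hy) g1 g2)
  have hg : AnalyticOnNhd ℂ (Ht l ρ) U := by
    rintro _ ⟨y, hy, rfl⟩
    exact Ht_an l ρ (mem_slit_of_neg hy)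
  have h0 : ((-ε / 2 : ℝ) : ℂ) ∈ U := ⟨-ε / 2, by simp only [Set.mem_Iio]; linarith, rfl⟩
  refine hf.eqOn_of_preconnected_of_frequently_eq hg hU h0 ?_ ⟨x, hx, rfl⟩
  apply freq_of_real
  have : Set.Ioo (-ε) 0 ∈ 𝓝 (-ε / 2) := Ioo_mem_nhds (by linarith) (by linarith)
  filter_upwards [this] with y hy
  exact (hc y hy).2.symm

lemma neg_Mt (S : SubS l G ν ρ) {x : ℝ} (hx : x < 0) :
    Mt ν (om l G ρ (x : ℂ)) = mm l G ρ (x : ℂ) := by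
  have hH := neg_Ht S hx
  obtain ⟨M, h, C, w, h1, h2, h3, h4, h5, h6, h7, h8, h9, h10, h11, h12, h13, h14⟩ := neg_facts S hx
  obtain ⟨r, hr, hr1, -, -⟩ := Mt_neg ν h13
  rw [h5, Ht_eq, hr, Tfun_real, h2] at hH
  have e : w * Tr l r = h := by exact_mod_cast hH
  rw [h5, hr, h4]
  have : Tr l r = Tr l (M - C) := by
    have := e.trans h6.symm
    exact mul_left_cancel₀ h13.ne this
  rw [Tr_inj S.hl hr1 (by linarith) this]

lemma rho_zero (S : SubS l G ν ρ) : ρ {0} = 0 := by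
  obtain ⟨c, hc, R0, hR0, hg⟩ := S.grow
  have hb : ∀ x : ℝ, x < 0 → -x * (ρ.real {0} * (1 - l)) ≤ max R0 (1 / c) := by
    intro x hx
    have hMM := neg_Mt S hx
    obtain ⟨M, h, C, w, h1, h2, h3, h4, h5, h6, h7, h8, h9, h10, h11, h12, h13, h14⟩ := neg_facts S hx
    obtain ⟨r, hr, hr1, hr2, -⟩ := Mt_neg ν h13
    rw [h5, hr, h4] at hMM
    have e : r = M - C := by exact_mod_cast hMM
    have hC1 : -1 < C := by linarith
    obtain ⟨hl0, hl1⟩ := S.hl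
    have hlow : -x * (ρ.real {0} * (1 - l)) ≤ -h := by
      rw [h12, Tr]
      have a1 : 1 - l ≤ l * M + 1 := by nlinarith
      have a2 : ρ.real {0} * (1 - l) ≤ (l * M + 1) * (M + 1) := by
        rw [mul_comm]
        apply mul_le_mul a1 (by linarith) measureReal_nonneg (by linarith)
      nlinarith
    refine hlow.trans ?_
    rcases le_total (-h) R0 with h' | h'
    · exact h'.trans (le_max_left _ _)
    · refine le_trans ?_ (le_max_right _ _)
      have := hg (-h) h'
      rw [neg_neg, h3, Complex.norm_real, Real.norm_eq_abs, sq_abs] at this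
      rw [le_div_iff₀ hc]
      nlinarith
  by_contra hne
  have hpos : 0 < ρ.real {0} := ENNReal.toReal_pos hne (measure_ne_top _ _)
  have hk : 0 < ρ.real {0} * (1 - l) := mul_pos hpos (by linarith [S.hl.2])
  have hB : 0 < max R0 (1 / c) := by positivity
  have := hb (-(2 * max R0 (1 / c) / (ρ.real {0} * (1 - l)))) (by
    rw [neg_lt_zero]; positivity)
  rw [neg_neg, div_mul_cancel₀ _ hk.ne'] at this
  linarith
end

section

variable {l : ℝ} {G ν ρ : Measure ℝ} [IsFiniteMeasure G] [IsProbabilityMeasure ν] [IsProbabilityMeasure ρ]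

lemma om_re_deriv (S : SubS l G ν ρ) {x : ℝ} (hx : x < 0) :
    HasDerivAt (fun x : ℝ => (om l G ρ (x : ℂ)).re) (deriv (om l G ρ) (x : ℂ)).re x := by
  obtain ⟨g1, g2, g3⟩ := neg_good S hx
  exact (om_an (mem_slit_of_neg hx) g1 g2).differentiableAt.hasDerivAt.real_of_complex

lemma exists_xi (S : SubS l G ν ρ) : ∃ ξ : ℝ, ξ < 0 ∧ 0 < (deriv (om l G ρ) (ξ : ℂ)).re := by
  have hf : ∀ x : ℝ, x < 0 → (om l G ρ (x : ℂ)).re < 0 ∧ x ≤ (om l G ρ (x : ℂ)).re := by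
    intro x hx
    obtain ⟨M, h, C, w, h1, h2, h3, h4, h5, h6, h7, h8, h9, h10, h11, h12, h13, h14⟩ := neg_facts S hx
    rw [h5, Complex.ofReal_re]; exact ⟨h13, h14⟩
  set f := fun x : ℝ => (om l G ρ (x : ℂ)).re with hfdef
  obtain ⟨a1, a2⟩ := hf (-1) (by norm_num)
  change f (-1) < 0 at a1
  change -1 ≤ f (-1) at a2
  have hx1 : f (-1) / 2 < 0 := by linarith
  have hb := (hf (f (-1) / 2) hx1).2
  change f (-1) / 2 ≤ f (f (-1) / 2) at hb
  obtain ⟨c, hc, hd⟩ := exists_hasDerivAt_eq_slope f (fun x => (deriv (om l G ρ) (x : ℂ)).re)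
    (show (-1 : ℝ) < f (-1) / 2 by linarith)
    (fun x hx => (om_re_deriv S (show x < 0 by have := hx.2; linarith)).continuousAt.continuousWithinAt)
    (fun x hx => om_re_deriv S (show x < 0 by have := hx.2; linarith))
  refine ⟨c, by have := hc.2; linarith, ?_⟩
  rw [hd]
  apply div_pos <;> linarith

/-- The set where subordination holds. -/
def Om (l : ℝ) (G ν ρ : Measure ℝ) : Set ℂ :=
  {z | ∀ᶠ z' in 𝓝 z, 0 < (om l G ρ z').im ∧ Mt ν (om l G ρ z') = mm l G ρ z'}

lemma isOpen_Om : IsOpen (Om l G ν ρ) := by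
  rw [isOpen_iff_mem_nhds]
  intro z hz
  exact eventually_eventually_nhds.2 hz

lemma Om_facts (hl : l ∈ Set.Ioo (0 : ℝ) 1) {z : ℂ} (h1 : 0 < (om l G ρ z).im)
    (h2 : Mt ν (om l G ρ z) = mm l G ρ z) :
    Tfun l (mm l G ρ z) ≠ 0 ∧ Ht l ν (om l G ρ z) = Ht l ρ z ∧ 0 ≤ (mm l G ρ z).im ∧
      ((mm l G ρ z + ac l) / Ht l ρ z).im ≤ 0 := by
  have hT : Tfun l (mm l G ρ z) ≠ 0 := by
    intro h0
    rw [om, h0, div_zero] at h1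
    simp at h1
  have hH : Ht l ν (om l G ρ z) = Ht l ρ z := by
    rw [Ht_eq, h2, om, div_mul_cancel₀ _ hT]
  refine ⟨hT, hH, ?_, ?_⟩
  · rw [← h2]; exact Mt_im_nonneg ν h1
  · rw [← h2, ← hH]; exact (Ht_facts hl ν h1).2

lemma Ht_slit (S : SubS l G ν ρ) {z : ℂ} (hz : 0 < z.im) : Ht l ρ z ∈ slit := by
  obtain ⟨h1, h2⟩ := Ht_facts S.hl ρ hz
  exact mem_slit_alg h1 (Mt_im_pos ρ (rho_zero S) hz) h2

lemma Om_nonempty (S : SubS l G ν ρ) : ({z : ℂ | 0 < z.im} ∩ Om l G ν ρ).Nonempty := by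
  obtain ⟨ξ, hξ, hd⟩ := exists_xi S
  obtain ⟨g1, g2, g3⟩ := neg_good S hξ
  have hsl := mem_slit_of_neg hξ
  have hom := om_an hsl g1 g2
  -- near ξ the identity holds
  have hid : ∀ᶠ z in 𝓝 (ξ : ℂ), Mt ν (om l G ρ z) = mm l G ρ z := by
    have ha : AnalyticAt ℂ (fun z => Mt ν (om l G ρ z)) ξ := (Mt_an ν g3).comp hom
    refine (ha.frequently_eq_iff_eventually_eq (mm_an hsl g1)).1 ?_
    apply freq_of_real
    filter_upwards [Iio_mem_nhds hξ] with y hy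
    exact neg_Mt S hy
  have han : ∀ᶠ z in 𝓝 (ξ : ℂ), AnalyticAt ℂ (om l G ρ) z := hom.eventually_analyticAt
  -- the vertical line
  set γ : ℝ → ℂ := fun y => (ξ : ℂ) + y * I with hγ
  have hγ0 : γ 0 = ξ := by simp [hγ]
  have hγd : ∀ y, HasDerivAt γ I y := by
    intro y
    have := ((Complex.ofRealCLM.hasDerivAt (x := y)).mul_const I).const_add (ξ : ℂ)
    exact this.congr_deriv (by simp)
  have hgd : HasDerivAt (fun y : ℝ => (om l G ρ (γ y)).im) (deriv (om l G ρ) ξ).re 0 := by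
    have h1 : HasDerivAt (om l G ρ) (deriv (om l G ρ) ξ) (γ 0) := by
      rw [hγ0]; exact hom.differentiableAt.hasDerivAt
    have h2 := h1.comp (0 : ℝ) (hγd 0)
    have h3 := (Complex.imCLM.hasFDerivAt (x := om l G ρ (γ 0))).comp_hasDerivAt (0 : ℝ) h2
    refine h3.congr_deriv ?_
    simp
  have hs := eventually_nhdsWithin_sign_eq_of_deriv_pos (f := fun y : ℝ => (om l G ρ (γ y)).im) (x₀ := 0)
    (by rw [hgd.deriv]; exact hd) (by
      simp only [hγ0]
      obtain ⟨M, h, C, w, h1, h2, h3, h4, h5, -⟩ := neg_facts S hξ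
      rw [h5, Complex.ofReal_im])
  have hγc : Tendsto γ (𝓝 0) (𝓝 (ξ : ℂ)) := by
    have := (hγd 0).continuousAt.tendsto
    rwa [hγ0] at this
  have hev := (hs.and (hγc.eventually (hid.eventually_nhds.and han)))
  have hev2 : ∀ᶠ y in 𝓝[>] (0 : ℝ), _ := hev.filter_mono nhdsWithin_le_nhds
  obtain ⟨y, ⟨hy1, hy2, hy3⟩, hy4⟩ := (hev2.and self_mem_nhdsWithin).exists
  have hy : 0 < y := hy4
  have hpos : 0 < (om l G ρ (γ y)).im := by
    rw [sub_zero, sign_pos hy] at hy1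
    exact sign_eq_one_iff.1 hy1
  refine ⟨γ y, ?_, ?_⟩
  · simp [hγ, hy]
  · have : ∀ᶠ z in 𝓝 (γ y), 0 < (om l G ρ z).im :=
      (Complex.continuous_im.continuousAt.comp hy3.continuousAt).eventually (lt_mem_nhds hpos)
    exact this.and hy2

lemma Om_closed (S : SubS l G ν ρ) : closure (Om l G ν ρ) ∩ {z : ℂ | 0 < z.im} ⊆ Om l G ν ρ := by
  rintro z ⟨hzc, hz⟩
  simp only [Set.mem_ofPred_eq] at hz
  by_contra hnot
  have hsl := mem_slit_of_im hz.ne'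
  have hh := Ht_slit S hz
  have hHne := (Ht_facts S.hl ρ hz).1
  have hP := (Ht_facts S.hl ρ hz).2
  have hmm := mm_an (G := G) hsl hh
  have hNB : (𝓝[Om l G ν ρ] z).NeBot := mem_closure_iff_nhdsWithin_neBot.1 hzc
  have hOm : ∀ᶠ z' in 𝓝[Om l G ν ρ] z, 0 < (om l G ρ z').im ∧ Mt ν (om l G ρ z') = mm l G ρ z' := by
    filter_upwards [self_mem_nhdsWithin] with z' hz'
    exact hz'.self_of_nhds
  have c1 : Tendsto (fun z' => (mm l G ρ z').im) (𝓝[Om l G ν ρ] z) (𝓝 (mm l G ρ z).im) :=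
    (Complex.continuous_im.continuousAt.comp hmm.continuousAt).tendsto.mono_left nhdsWithin_le_nhds
  have c2 : Tendsto (fun z' => ((mm l G ρ z' + ac l) / Ht l ρ z').im) (𝓝[Om l G ν ρ] z)
      (𝓝 ((mm l G ρ z + ac l) / Ht l ρ z).im) := by
    have : ContinuousAt (fun z' => (mm l G ρ z' + ac l) / Ht l ρ z') z :=
      (hmm.continuousAt.add continuousAt_const).div (Ht_an l ρ hsl).continuousAt hHne
    exact (Complex.continuous_im.continuousAt.comp this).tendsto.mono_left nhdsWithin_le_nhds
  have hQ : 0 ≤ (mm l G ρ z).im := by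
    refine ge_of_tendsto c1 ?_
    filter_upwards [hOm] with z' hz'
    exact (Om_facts S.hl hz'.1 hz'.2).2.2.1
  have hQ' : ((mm l G ρ z + ac l) / Ht l ρ z).im ≤ 0 := by
    refine le_of_tendsto c2 ?_
    filter_upwards [hOm] with z' hz'
    exact (Om_facts S.hl hz'.1 hz'.2).2.2.2
  obtain ⟨p, q, hp, hq, hC, -⟩ := C_decomp G S.hG hh
  obtain ⟨hT, him⟩ := alg S.hl.1 hp hq hC (Ht_eq l ρ z) hHne hz.le (Mt_im_pos ρ (rho_zero S) hz) hP hQ hQ'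
  have hom : AnalyticAt ℂ (om l G ρ) z := om_an hsl hh hT
  have him' : 0 < (om l G ρ z).im := him
  apply hnot
  have e1 : ∀ᶠ z' in 𝓝 z, 0 < (om l G ρ z').im :=
      (Complex.continuous_im.continuousAt.comp hom.continuousAt).eventually (lt_mem_nhds him')
  have e2 : ∀ᶠ z' in 𝓝 z, Mt ν (om l G ρ z') = mm l G ρ z' := by
    have ha : AnalyticAt ℂ (fun z => Mt ν (om l G ρ z)) z :=
      (Mt_an ν (mem_slit_of_im him'.ne')).comp hom
    refine (ha.frequently_eq_iff_eventually_eq hmm).1 ?_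
    have : 𝓝[Om l G ν ρ] z ≤ 𝓝[≠] z := by
      apply nhdsWithin_mono
      intro z' hz' h0
      rw [mem_singleton_iff] at h0
      rw [h0] at hz'
      exact hnot hz'
    have h3 : ∃ᶠ z' in 𝓝[Om l G ν ρ] z, Mt ν (om l G ρ z') = mm l G ρ z' :=
      (hOm.mono fun z' h => h.2).frequently
    exact h3.filter_mono this
  exact e1.and e2

theorem subord (S : SubS l G ν ρ) {z : ℂ} (hz : 0 < z.im) :
    Ht l ρ z ∈ slit ∧ 0 < (om l G ρ z).im ∧ Mt ν (om l G ρ z) = mm l G ρ z ∧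
    Ht l ν (om l G ρ z) = Ht l ρ z ∧ Tfun l (mm l G ρ z) ≠ 0 ∧ 0 ≤ (mm l G ρ z).im ∧
      ((mm l G ρ z + ac l) / Ht l ρ z).im ≤ 0 := by
  have hc : IsPreconnected {z : ℂ | 0 < z.im} := (convex_halfSpace_im_gt 0).isPreconnected
  have hsub := hc.subset_of_closure_inter_subset isOpen_Om (Om_nonempty S) (Om_closed S)
  have h := (hsub (show z ∈ {z : ℂ | 0 < z.im} from hz)).self_of_nhds
  obtain ⟨a1, a2, a3, a4⟩ := Om_facts S.hl h.1 h.2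
  exact ⟨Ht_slit S hz, h.1, h.2, a2, a1, a3, a4⟩
end

section

lemma sector {u : ℂ} {κ s : ℝ} (hκ : 0 < κ) (hκ1 : κ ≤ 1) (hs : 0 ≤ s) (h : κ * ‖u‖ ≤ |u.im|) :
    κ / 3 * (‖u‖ + s) ≤ ‖u - s‖ := by
  have h1 : |u.im| ≤ ‖u - s‖ := by
    have := Complex.abs_im_le_norm (u - s)
    simpa using this
  have h2 : s - ‖u‖ ≤ ‖u - s‖ := by
    have := norm_sub_norm_le (s : ℂ) u
    rw [norm_sub_rev, Complex.norm_real, Real.norm_eq_abs, abs_of_nonneg hs] at this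
    exact this
  have hu := norm_nonneg u
  rcases le_total s (2 * ‖u‖) with h3 | h3
  · nlinarith
  · nlinarith

lemma sector2 {u : ℂ} {κ s : ℝ} (hκ : 0 < κ) (hκ1 : κ ≤ 1) (hs : 0 ≤ s) (h : κ * ‖u‖ ≤ |u.im|) :
    (κ / 3) ^ 2 * (‖u‖ ^ 2 + s ^ 2) ≤ ‖u ^ 2 - (s : ℂ) ^ 2‖ := by
  have h1 := sector hκ hκ1 hs h
  have h2 := sector (u := -u) hκ hκ1 hs (by simpa using h)
  rw [norm_neg] at h2
  have e : u ^ 2 - (s : ℂ) ^ 2 = - ((u - s) * (-u - s)) := by ring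
  rw [e, norm_neg, norm_mul]
  have hu := norm_nonneg u
  have h3 := mul_le_mul h1 h2 (by positivity) (norm_nonneg _)
  refine le_trans ?_ h3
  have : (κ / 3) ^ 2 * (‖u‖ ^ 2 + s ^ 2) ≤ (κ / 3) ^ 2 * (‖u‖ + s) ^ 2 := by
    apply mul_le_mul_of_nonneg_left _ (by positivity)
    nlinarith [mul_nonneg hu hs]
  nlinarith

lemma Mt_bdd (ν : Measure ℝ) [IsProbabilityMeasure ν] {w : ℂ} (hw : w ≠ 0) {k : ℝ} (hk : 0 < k)
    (h : ∀ s : ℝ, 0 ≤ s → k * s ≤ ‖1 / w - s‖) : ‖Mt ν w‖ ≤ 1 / k := by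
  have : ∀ t : ℝ, ‖w * (t : ℂ) ^ 2 / (1 - w * (t : ℂ) ^ 2)‖ ≤ 1 / k := by
    intro t
    have e : w * (t : ℂ) ^ 2 / (1 - w * (t : ℂ) ^ 2) = (t : ℂ) ^ 2 / (1 / w - (t : ℂ) ^ 2) := by
      have : 1 - w * (t : ℂ) ^ 2 = w * (1 / w - (t : ℂ) ^ 2) := by field_simp
      rw [this, mul_div_mul_left _ _ hw]
    have h1 := h (t ^ 2) (sq_nonneg t)
    push_cast at h1
    rw [e, norm_div]
    apply div_le_of_le_mul₀ (norm_nonneg _) (by positivity)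
    rw [norm_pow, Complex.norm_real, Real.norm_eq_abs, sq_abs, div_mul_eq_mul_div, one_mul, le_div_iff₀ hk]
    linarith
  have h2 := norm_integral_le_of_norm_le_const (μ := ν) (Eventually.of_forall this)
  simpa [Mt] using h2

def bc (l : ℝ) : ℂ := ((1 - l) ^ 2 / (4 * l) : ℝ)

lemma T_sq {l : ℝ} (hl : 0 < l) (M : ℂ) : Tfun l M = l * (M + ac l) ^ 2 - bc l := by
  have hlC : (l : ℂ) ≠ 0 := by exact_mod_cast hl.ne'
  unfold Tfun ac bc
  push_cast
  field_simp
  ring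

lemma core {d k cg p q : ℝ} {P h C : ℂ} (hd : 0 < d) (hd1 : d ≤ 1) (hk : 0 < k) (hcg : 0 < cg)
    (hp : 0 < p) (hq : 0 ≤ q) (hP : P ≠ 0) (hPim : d * ‖P‖ ≤ P.im)
    (hhP : ‖h / P ^ 2 - k‖ ≤ k * d / 2) (hC : C = p * h - q)
    (hE : cg * ‖h‖ ≤ (p * ‖h‖ + q) ^ 2) :
    d / 4 / (1 + 1 / √(cg * k / 2)) * ‖1 - C / P‖ ≤ |(1 - C / P).im| ∧
      d / 4 * √(cg * k / 2) ≤ ‖1 - C / P‖ := by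
  have hPn : 0 < ‖P‖ := norm_pos_iff.2 hP
  set E0 := √(cg * k / 2) with hE0
  have hE0pos : 0 < E0 := Real.sqrt_pos.2 (by positivity)
  set E := (p * ‖h‖ + q) / ‖P‖ with hEdef
  set r := h / P ^ 2 - k with hr
  have hhr : h / P ^ 2 = k + r := by rw [hr]; ring
  have e1 : h / P = k * P + r * P := by
    have : h / P = (h / P ^ 2) * P := by field_simp
    rw [this, hhr]; ring
  have hrP : ‖r * P‖ ≤ k * d / 2 * ‖P‖ := by
    rw [norm_mul]; exact mul_le_mul_of_nonneg_right hhP hPn.le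
  have i1 : k * d / 2 * ‖P‖ ≤ (h / P).im := by
    rw [e1, Complex.add_im, Complex.im_ofReal_mul]
    have := (neg_abs_le (r * P).im)
    have := Complex.abs_im_le_norm (r * P)
    nlinarith
  have i2 : ‖h / P‖ ≤ 2 * k * ‖P‖ := by
    rw [e1]
    refine (norm_add_le _ _).trans ?_
    rw [norm_mul, Complex.norm_real, Real.norm_eq_abs, abs_of_pos hk]
    have : k * d / 2 * ‖P‖ ≤ k * ‖P‖ := by
      apply mul_le_mul_of_nonneg_right _ hPn.le
      nlinarith
    linarith
  have i3 : d / 4 * ‖h / P‖ ≤ (h / P).im := by nlinarith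
  have i4 : k / 2 * ‖P‖ ^ 2 ≤ ‖h‖ := by
    have : k - k * d / 2 ≤ ‖h / P ^ 2‖ := by
      have := norm_sub_norm_le (k : ℂ) (-r)
      rw [sub_neg_eq_add, ← hhr, norm_neg, Complex.norm_real, Real.norm_eq_abs, abs_of_pos hk] at this
      linarith
    rw [norm_div, norm_pow, le_div_iff₀ (by positivity)] at this
    refine le_trans ?_ this
    apply mul_le_mul_of_nonneg_right _ (by positivity)
    nlinarith
  have hEE0 : E0 ≤ E := by
    rw [hE0, Real.sqrt_le_left (by positivity)]
    rw [hEdef, div_pow, le_div_iff₀ (by positivity)]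
    refine le_trans ?_ hE
    nlinarith
  have hDn : ‖C / P‖ ≤ E := by
    rw [hEdef, norm_div]
    apply div_le_div_of_nonneg_right _ hPn.le
    rw [hC]
    refine (norm_sub_le _ _).trans ?_
    rw [norm_mul, Complex.norm_real, Complex.norm_real, Real.norm_eq_abs, Real.norm_eq_abs,
      abs_of_pos hp, abs_of_nonneg hq]
  have hDi : d / 4 * E ≤ (C / P).im := by
    have e2 : C / P = p * (h / P) - q * P⁻¹ := by rw [hC]; field_simp
    rw [e2, Complex.sub_im, Complex.im_ofReal_mul, Complex.im_ofReal_mul, Complex.inv_im]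
    have e3 : d / 4 * ‖P‖⁻¹ ≤ P.im / normSq P := by
      rw [Complex.normSq_eq_norm_sq, ← div_eq_mul_inv, div_le_div_iff₀ hPn (by positivity)]
      nlinarith [mul_pos hPn hPn]
    have e4 : E = p * ‖h / P‖ + q * ‖P‖⁻¹ := by rw [hEdef, norm_div]; field_simp
    rw [e4, neg_div]
    nlinarith [mul_le_mul_of_nonneg_left i3 hp.le, mul_le_mul_of_nonneg_left e3 hq]
  have hEpos : 0 < E := hE0pos.trans_le hEE0
  have hui : d / 4 * E ≤ |(1 - C / P).im| := by
    rw [Complex.sub_im, Complex.one_im, zero_sub, abs_neg]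
    exact hDi.trans (le_abs_self _)
  constructor
  · have hun : ‖1 - C / P‖ ≤ (1 + 1 / E0) * E := by
      refine (norm_sub_le _ _).trans ?_
      rw [norm_one]
      have : 1 ≤ 1 / E0 * E := by rw [div_mul_eq_mul_div, one_mul, le_div_iff₀ hE0pos]; linarith
      linarith
    refine le_trans ?_ hui
    rw [div_mul_eq_mul_div, div_le_iff₀ (by positivity)]
    nlinarith
  · have := hui.trans (Complex.abs_im_le_norm _)
    refine le_trans ?_ this
    apply mul_le_mul_of_nonneg_left hEE0 (by positivity)

variable {l : ℝ} {G ν ρ : Measure ℝ} [IsFiniteMeasure G] [IsProbabilityMeasure ν] [IsProbabilityMeasure ρ]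

theorem no_infty (S : SubS l G ν ρ) {x : ℝ} (hx : 0 < x) {δ : ℝ} (hδ : 0 < δ) {z : ℕ → ℂ}
    (hz : Tendsto z atTop (𝓝 (x : ℂ))) (him : ∀ n, 0 < (z n).im)
    (hM : Tendsto (fun n => ‖Mt ρ (z n)‖) atTop atTop)
    (hcone : ∀ n, δ * ‖Mt ρ (z n)‖ ≤ (Mt ρ (z n)).im) : False := by
  obtain ⟨hl0, hl1⟩ := id S.hl
  obtain ⟨cg, hcg, R0, hR0, hgrow⟩ := S.grow
  set P : ℕ → ℂ := fun n => Mt ρ (z n) + ac l with hP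
  set h : ℕ → ℂ := fun n => Ht l ρ (z n) with hh
  -- |P| → ∞
  have hPinf : Tendsto (fun n => ‖P n‖) atTop atTop := by
    refine tendsto_atTop_mono (fun n => ?_) (tendsto_atTop_add_const_right _ (-‖ac l‖) hM)
    have := norm_sub_le (P n) (ac l)
    have e : P n - ac l = Mt ρ (z n) := by simp [hP]
    rw [e] at this
    linarith
  have hP0 : ∀ᶠ n in atTop, P n ≠ 0 := by
    filter_upwards [hPinf.eventually_gt_atTop 0] with n hn
    exact norm_pos_iff.1 hn
  set k := l * x with hk
  have hkpos : 0 < k := mul_pos hl0 hx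
  have hPinv : Tendsto (fun n => (P n)⁻¹) atTop (𝓝 0) := by
    rw [tendsto_zero_iff_norm_tendsto_zero]
    simp only [norm_inv]
    exact hPinf.inv_tendsto_atTop
  have hhP : ∀ᶠ n in atTop, h n / (P n) ^ 2 = z n * (l - bc l * ((P n)⁻¹) ^ 2) := by
    filter_upwards [hP0] with n hn
    simp only [hh]
    rw [Ht_eq, T_sq hl0]
    change z n * (l * (P n) ^ 2 - bc l) / (P n) ^ 2 = _
    field_simp
  have hlim : Tendsto (fun n => h n / (P n) ^ 2) atTop (𝓝 (k : ℂ)) := by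
    rw [tendsto_congr' hhP]
    have : Tendsto (fun n => z n * (l - bc l * ((P n)⁻¹) ^ 2)) atTop (𝓝 ((x : ℂ) * (l - bc l * 0 ^ 2))) :=
      hz.mul (tendsto_const_nhds.sub ((hPinv.pow 2).const_mul _))
    convert this using 2
    simp [hk, mul_comm]
  have hkC : (k : ℂ) ≠ 0 := by exact_mod_cast hkpos.ne'
  have hlim2 : Tendsto (fun n => k / (h n / (P n) ^ 2)) atTop (𝓝 1) := by
    have := (tendsto_const_nhds (x := (k : ℂ))).div hlim hkC
    rwa [div_self hkC] at this
  have hhinv : Tendsto (fun n => (h n)⁻¹) atTop (𝓝 0) := by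
    have h1 : Tendsto (fun n => (h n / (P n) ^ 2)⁻¹ * ((P n)⁻¹) ^ 2) atTop (𝓝 ((k : ℂ)⁻¹ * 0 ^ 2)) :=
      (hlim.inv₀ hkC).mul (hPinv.pow 2)
    have h2 : (k : ℂ)⁻¹ * 0 ^ 2 = 0 := by simp
    rw [h2] at h1
    refine h1.congr' ?_
    filter_upwards [hP0] with n hn
    rw [inv_div]
    field_simp
  have hhinf : Tendsto (fun n => ‖h n‖) atTop atTop := by
    have h1 : Tendsto (fun n => ‖h n / (P n) ^ 2‖ * (‖P n‖ ^ 2)) atTop atTop := by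
      have : Tendsto (fun n => ‖P n‖ ^ 2) atTop atTop := (tendsto_pow_atTop two_ne_zero).comp hPinf
      refine Tendsto.pos_mul_atTop (C := ‖(k : ℂ)‖) (norm_pos_iff.2 hkC) hlim.norm this
    refine h1.congr' ?_
    filter_upwards [hP0] with n hn
    have := norm_pos_iff.2 hn
    rw [norm_div, norm_pow]
    field_simp
  -- constants
  set d := min (δ / 2) 1 with hd
  have hdpos : 0 < d := by positivity
  have hd1 : d ≤ 1 := min_le_right _ _
  set E0 := √(cg * k / 2) with hE0
  have hE0pos : 0 < E0 := Real.sqrt_pos.2 (by positivity)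
  set κ := d / 4 / (1 + 1 / E0) with hκ
  have hκpos : 0 < κ := by positivity
  have hκ1 : κ ≤ 1 := by
    rw [hκ, div_le_one (by positivity)]
    have : 0 < 1 / E0 := by positivity
    linarith
  set η := d / 4 * E0 with hη
  have hηpos : 0 < η := by positivity
  set c := (κ / 3) ^ 2 with hc
  have hcpos : 0 < c := by positivity
  have ev1 : ∀ᶠ n in atTop, ‖h n / (P n) ^ 2 - k‖ ≤ k * d / 2 := by
    have := (tendsto_iff_norm_sub_tendsto_zero.1 hlim).eventually_le_const (show (0 : ℝ) < k * d / 2 by positivity)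
    exact this
  have ev2 : ∀ᶠ n in atTop, ‖k / (h n / (P n) ^ 2) - 1‖ ≤ c / 4 :=
    (tendsto_iff_norm_sub_tendsto_zero.1 hlim2).eventually_le_const (by positivity)
  have ev3 : ∀ᶠ n in atTop, ‖x * bc l * (h n)⁻¹‖ ≤ c * η ^ 2 / 4 := by
    have h1 : Tendsto (fun n => ‖x * bc l * (h n)⁻¹‖) atTop (𝓝 0) := by
      have := (hhinv.const_mul (x * bc l)).norm
      simpa using this
    exact h1.eventually_le_const (by positivity)
  obtain ⟨n, e1, e2, e3, e4, e5, e6, e7⟩ := (ev1.and (ev2.and (ev3.and (hP0.and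
    ((hPinf.eventually_gt_atTop ((1 / (c / 2) + ‖ac l‖) / η)).and
    ((hhinf.eventually_ge_atTop R0).and (hM.eventually_ge_atTop ‖ac l‖))))))).exists
  obtain ⟨s1, s2, s3, s4, s5, s6, s7⟩ := subord S (him n)
  obtain ⟨p, q, hp, hq, hC, hCn⟩ := C_decomp G S.hG s1
  change h n ∈ slit at s1
  change rectC G (h n) = p * h n - q at hC
  change ‖rectC G ((-‖h n‖ : ℝ) : ℂ)‖ ≤ p * ‖h n‖ + q at hCn
  have hE : cg * ‖h n‖ ≤ (p * ‖h n‖ + q) ^ 2 :=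
    (hgrow _ e6).trans (pow_le_pow_left₀ (norm_nonneg _) hCn 2)
  have hPim : d * ‖P n‖ ≤ (P n).im := by
    have a1 : (P n).im = (Mt ρ (z n)).im := by simp [hP, ac_im]
    have a2 : ‖P n‖ ≤ 2 * ‖Mt ρ (z n)‖ := by
      refine (norm_add_le _ _).trans ?_
      linarith
    rw [a1]
    refine le_trans ?_ (hcone n)
    have : d ≤ δ / 2 := min_le_left _ _
    have := norm_nonneg (P n)
    nlinarith
  obtain ⟨u1, u2⟩ := core hdpos hd1 hkpos hcg hp hq e4 hPim e1 hC hE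
  set u := 1 - rectC G (h n) / P n with hu
  rw [← hE0, ← hκ] at u1
  rw [← hE0, ← hη] at u2
  have hQ : mm l G ρ (z n) + ac l = u * P n := by
    rw [hu, sub_mul, div_mul_cancel₀ _ e4, mm, one_mul]
    change Mt ρ (z n) - rectC G (h n) + ac l = Mt ρ (z n) + ac l - rectC G (h n)
    ring
  have hhne : h n ≠ 0 := by
    have := hR0.trans_le e6
    exact norm_pos_iff.1 this
  have homne : om l G ρ (z n) ≠ 0 := by
    intro h0; rw [h0] at s2; simp at s2
  have hv : x * (1 / om l G ρ (z n)) = (k / (h n / (P n) ^ 2)) * u ^ 2 - x * bc l * (h n)⁻¹ := by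
    have a1 : om l G ρ (z n) = h n / Tfun l (mm l G ρ (z n)) := rfl
    rw [a1, one_div_div, T_sq hl0, hQ, hk]
    push_cast
    field_simp
  have hbound : ∀ s : ℝ, 0 ≤ s → c / 2 * s ≤ ‖1 / om l G ρ (z n) - s‖ := by
    intro s hs
    have b1 := sector2 hκpos hκ1 (Real.sqrt_nonneg (x * s)) u1
    have b2 : (√(x * s)) ^ 2 = x * s := Real.sq_sqrt (by positivity)
    have b3 : ((√(x * s) : ℝ) : ℂ) ^ 2 = ((x * s : ℝ) : ℂ) := by exact_mod_cast congrArg (fun r : ℝ => (r : ℂ)) b2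
    rw [b3, b2, ← hc] at b1
    have b4 : u ^ 2 - ((x * s : ℝ) : ℂ) = x * (1 / om l G ρ (z n) - s) - (k / (h n / (P n) ^ 2) - 1) * u ^ 2
        + x * bc l * (h n)⁻¹ := by
      rw [mul_sub, hv]; push_cast; ring
    have b5 : ‖u ^ 2 - ((x * s : ℝ) : ℂ)‖ ≤ x * ‖1 / om l G ρ (z n) - s‖ + c / 4 * ‖u‖ ^ 2 + c * η ^ 2 / 4 := by
      rw [b4]
      refine (norm_add_le _ _).trans (add_le_add ((norm_sub_le _ _).trans (add_le_add ?_ ?_)) e3)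
      · rw [norm_mul, Complex.norm_real, Real.norm_eq_abs, abs_of_pos hx]
      · rw [norm_mul, norm_pow]; apply mul_le_mul_of_nonneg_right e2 (by positivity)
    have b6 : η ^ 2 ≤ ‖u‖ ^ 2 := pow_le_pow_left₀ hηpos.le u2 2
    have b7 : x * (c / 2 * s) ≤ x * ‖1 / om l G ρ (z n) - s‖ := by
      have : c * η ^ 2 ≤ c * ‖u‖ ^ 2 := mul_le_mul_of_nonneg_left b6 hcpos.le
      have : 0 ≤ c * ‖u‖ ^ 2 := by positivity
      have : 0 ≤ c * (x * s) := by positivity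
      nlinarith
    exact le_of_mul_le_mul_left b7 hx
  have hfin := Mt_bdd ν homne (by positivity) hbound
  rw [s3] at hfin
  have f1 : η * ‖P n‖ ≤ ‖mm l G ρ (z n)‖ + ‖ac l‖ := by
    have : ‖u * P n‖ ≤ _ := hQ ▸ norm_add_le (mm l G ρ (z n)) (ac l)
    rw [norm_mul] at this
    refine le_trans ?_ this
    apply mul_le_mul_of_nonneg_right u2 (norm_nonneg _)
  rw [div_lt_iff₀ hηpos] at e5
  linarith
end

section

/-- points of the positive axis through which `M_ρ` extends analytically from above. -/
def Xreg (ρ : Measure ℝ) : Set ℝ :=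
  {x | 0 < x ∧ ∃ F : ℂ → ℂ, AnalyticAt ℂ F (x : ℂ) ∧ ∀ᶠ z in 𝓝 (x : ℂ), 0 < z.im → Mt ρ z = F z}

/-- inverse of the subordination function. -/
def Phi (l : ℝ) (G ν : Measure ℝ) (w : ℂ) : ℂ :=
  Ht l ν w / Tfun l (Mt ν w + rectC G (Ht l ν w))

/-- isolated zeros. -/
def isoZ (f : ℂ → ℂ) : Set ℂ := {w | f w = 0 ∧ ∀ᶠ w' in 𝓝[≠] w, f w' ≠ 0}

lemma isoZ_countable (f : ℂ → ℂ) : (isoZ f).Countable := by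
  refine IsLindelof.countable (HereditarilyLindelofSpace.isLindelof _) ?_
  rw [discreteTopology_subtype_iff]
  rintro w ⟨-, hw⟩
  rw [← Filter.empty_mem_iff_bot]
  have h1 : isoZ f ∈ 𝓝[≠] w ⊓ 𝓟 (isoZ f) := mem_inf_of_right (mem_principal_self _)
  have h2 : {w' | f w' ≠ 0} ∈ 𝓝[≠] w ⊓ 𝓟 (isoZ f) := mem_inf_of_left hw
  filter_upwards [h1, h2] with w' a b
  exact b a.1

/-- exceptional points -/
def Exc (l : ℝ) (G ν : Measure ℝ) : Set ℝ :=
  (fun x : ℝ => (x : ℂ)) ⁻¹' (Phi l G ν '' isoZ (deriv (Phi l G ν)))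

lemma Exc_countable (l : ℝ) (G ν : Measure ℝ) : (Exc l G ν).Countable :=
  ((isoZ_countable _).image _).preimage Complex.ofReal_injective

lemma Tfun_ne {l : ℝ} (hl : 0 < l) {M : ℂ} (hM : 0 < M.im) : Tfun l M ≠ 0 := by
  unfold Tfun
  apply mul_ne_zero
  · intro h
    have := congrArg Complex.im h
    simp at this
    rcases this with h | h <;> linarith
  · intro h
    have := congrArg Complex.im h
    simp at this
    linarith

variable {l : ℝ} {G ν ρ : Measure ℝ} [IsFiniteMeasure G] [IsProbabilityMeasure ν] [IsProbabilityMeasure ρ]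

lemma Phi_om (S : SubS l G ν ρ) {z : ℂ} (hz : 0 < z.im) : Phi l G ν (om l G ρ z) = z := by
  obtain ⟨s1, s2, s3, s4, s5, s6, s7⟩ := subord S hz
  have hT := Tfun_ne S.hl.1 (Mt_im_pos ρ (rho_zero S) hz)
  rw [Phi, s3, s4, mm, sub_add_cancel, Ht_eq, mul_div_cancel_right₀ _ hT]

theorem case_a (S : SubS l G ν ρ) {x : ℝ} (hx : 0 < x) {z : ℕ → ℂ}
    (hz : Tendsto z atTop (𝓝 (x : ℂ))) (him : ∀ n, 0 < (z n).im) {M0 : ℂ}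
    (hM : Tendsto (fun n => Mt ρ (z n)) atTop (𝓝 M0)) (hM0 : 0 < M0.im) :
    x ∈ Xreg ρ ∪ Exc l G ν := by
  have hxC : (x : ℂ) ≠ 0 := by exact_mod_cast hx.ne'
  have hT0 := Tfun_ne S.hl.1 hM0
  set h0 : ℂ := x * Tfun l M0 with hh0
  have hh0ne : h0 ≠ 0 := mul_ne_zero hxC hT0
  have hlim : Tendsto (fun n => Ht l ρ (z n)) atTop (𝓝 h0) := by
    simp only [Ht_eq]
    exact hz.mul ((Tfun_an l M0).continuousAt.tendsto.comp hM)
  have hP0 : ((M0 + ac l) / h0).im ≤ 0 := by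
    have : Tendsto (fun n => ((Mt ρ (z n) + ac l) / Ht l ρ (z n)).im) atTop (𝓝 ((M0 + ac l) / h0).im) :=
      (Complex.continuous_im.tendsto _).comp ((hM.add_const _).div hlim hh0ne)
    exact le_of_tendsto this (Eventually.of_forall fun n => (Ht_facts S.hl ρ (him n)).2)
  have hslit : h0 ∈ slit := mem_slit_alg hh0ne hM0 hP0
  set C0 := rectC G h0 with hC0
  have hClim : Tendsto (fun n => rectC G (Ht l ρ (z n))) atTop (𝓝 C0) :=
    (rectC_an G hslit).continuousAt.tendsto.comp hlim
  have hmlim : Tendsto (fun n => mm l G ρ (z n)) atTop (𝓝 (M0 - C0)) := hM.sub hClim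
  have hQ : 0 ≤ (M0 - C0).im := by
    have : Tendsto (fun n => (mm l G ρ (z n)).im) atTop (𝓝 (M0 - C0).im) :=
      (Complex.continuous_im.tendsto _).comp hmlim
    exact ge_of_tendsto this (Eventually.of_forall fun n => (subord S (him n)).2.2.2.2.2.1)
  have hQ' : ((M0 - C0 + ac l) / h0).im ≤ 0 := by
    have : Tendsto (fun n => ((mm l G ρ (z n) + ac l) / Ht l ρ (z n)).im) atTop
        (𝓝 ((M0 - C0 + ac l) / h0).im) :=
      (Complex.continuous_im.tendsto _).comp ((hmlim.add_const _).div hlim hh0ne)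
    exact le_of_tendsto this (Eventually.of_forall fun n => (subord S (him n)).2.2.2.2.2.2)
  obtain ⟨p, q, hp, hq, hC, -⟩ := C_decomp G S.hG hslit
  obtain ⟨hTm, hω⟩ := alg S.hl.1 hp hq hC hh0 hh0ne (by simp) hM0 hP0 hQ hQ'
  set w0 := h0 / Tfun l (M0 - C0) with hw0
  have hwlim : Tendsto (fun n => om l G ρ (z n)) atTop (𝓝 w0) :=
    hlim.div ((Tfun_an l _).continuousAt.tendsto.comp hmlim) hTm
  have hwslit := mem_slit_of_im hω.ne'
  have hMν : Mt ν w0 = M0 - C0 := by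
    refine tendsto_nhds_unique ((Mt_an ν hwslit).continuousAt.tendsto.comp hwlim) ?_
    refine hmlim.congr fun n => ?_
    exact (subord S (him n)).2.2.1.symm
  have hHν : Ht l ν w0 = h0 := by
    rw [Ht_eq, hMν, hw0, div_mul_cancel₀ _ hTm]
  have hΦx : Phi l G ν w0 = x := by
    rw [Phi, hMν, hHν, ← hC0, sub_add_cancel, hh0, mul_div_cancel_right₀ _ hT0]
  have hHa := Ht_an l ν hwslit
  have hCa : AnalyticAt ℂ (fun w => rectC G (Ht l ν w)) w0 := by
    refine AnalyticAt.comp (g := rectC G) ?_ hHa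
    rw [hHν]; exact rectC_an G hslit
  have hMa : AnalyticAt ℂ (fun w => Mt ν w + rectC G (Ht l ν w)) w0 := (Mt_an ν hwslit).add hCa
  have hΦa : AnalyticAt ℂ (Phi l G ν) w0 := by
    refine hHa.div ((Tfun_an l _).comp hMa) ?_
    rw [hMν, hHν, ← hC0, sub_add_cancel]; exact hT0
  by_cases hd : deriv (Phi l G ν) w0 = 0
  · right
    refine ⟨w0, ⟨hd, ?_⟩, hΦx⟩
    rcases hΦa.deriv.eventually_eq_zero_or_eventually_ne_zero with h | h
    · exfalso
      obtain ⟨r, hr, hball⟩ := Metric.eventually_nhds_iff_ball.1 (h.and hΦa.eventually_analyticAt)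
      have hconst : ∀ w ∈ Metric.ball w0 r, Phi l G ν w = Phi l G ν w0 := fun w hw =>
        Metric.isOpen_ball.is_const_of_deriv_eq_zero (convex_ball w0 r).isPreconnected
          (fun w hw => (hball w hw).2.differentiableAt.differentiableWithinAt)
          (fun w hw => (hball w hw).1) hw (Metric.mem_ball_self hr)
      obtain ⟨n, hn⟩ := (hwlim.eventually (Metric.ball_mem_nhds w0 hr)).exists
      have := hconst _ hn
      rw [Phi_om S (him n), hΦx] at this
      have h2 := him n
      rw [this] at h2
      simp at h2
    · exact h
  · left
    refine ⟨hx, ?_⟩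
    set Ψ := hΦa.hasStrictDerivAt.localInverse _ _ _ hd with hΨ
    have hΨa : AnalyticAt ℂ Ψ (x : ℂ) := by
      have := hΦa.analyticAt_localInverse hd
      rwa [hΦx] at this
    have hΨl : ∀ᶠ w in 𝓝 w0, Ψ (Phi l G ν w) = w := HasStrictDerivAt.eventually_left_inverse ..
    have hΨx : Ψ x = w0 := by
      have := hΨl.self_of_nhds
      rwa [hΦx] at this
    obtain ⟨r, hr, hball⟩ := Metric.eventually_nhds_iff_ball.1 hΨa.eventually_analyticAt
    set D := Metric.ball (x : ℂ) r ∩ {z : ℂ | 0 < z.im} with hD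
    have hDc : IsPreconnected D := ((convex_ball _ _).inter (convex_halfSpace_im_gt 0)).isPreconnected
    have homa : ∀ z : ℂ, 0 < z.im → AnalyticAt ℂ (om l G ρ) z := fun z hz =>
      om_an (mem_slit_of_im hz.ne') (subord S hz).1 (subord S hz).2.2.2.2.1
    have heq : EqOn (om l G ρ) Ψ D := by
      obtain ⟨n, hn1, hn2⟩ := ((hz.eventually (Metric.ball_mem_nhds _ hr)).and
        (hwlim.eventually hΨl.eventually_nhds)).exists
      have hDn : z n ∈ D := ⟨hn1, him n⟩
      refine AnalyticOnNhd.eqOn_of_preconnected_of_eventuallyEq (fun w hw => homa w hw.2)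
        (fun w hw => hball w hw.1) hDc hDn ?_
      have h1 := (homa _ (him n)).continuousAt.eventually hn2
      have h2 : ∀ᶠ w in 𝓝 (z n), 0 < w.im := Complex.continuous_im.continuousAt.eventually (lt_mem_nhds (him n))
      filter_upwards [h1, h2] with w a b
      rw [Phi_om S b] at a
      exact a.symm
    refine ⟨fun z => Mt ν (Ψ z) + rectC G (Ht l ν (Ψ z)), ?_, ?_⟩
    · refine AnalyticAt.comp (g := fun w => Mt ν w + rectC G (Ht l ν w)) ?_ hΨa
      rw [hΨx]; exact hMa
    · filter_upwards [Metric.ball_mem_nhds _ hr] with w hw hwim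
      rw [← heq ⟨hw, hwim⟩, (subord S hwim).2.2.1, (subord S hwim).2.2.2.1, mm, sub_add_cancel]
end

section

variable {l : ℝ} {G ν ρ : Measure ℝ} [IsFiniteMeasure G] [IsProbabilityMeasure ν] [IsProbabilityMeasure ρ]

theorem no_infty' (S : SubS l G ν ρ) {x : ℝ} (hx : 0 < x) {δ : ℝ} (hδ : 0 < δ) {z : ℕ → ℂ}
    (hz : Tendsto z atTop (𝓝 (x : ℂ))) (him : ∀ n, 0 < (z n).im)
    (hM : Tendsto (fun n => ‖Mt ρ (z n)‖) atTop atTop)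
    (hcone : ∀ᶠ n in atTop, δ * ‖Mt ρ (z n)‖ ≤ (Mt ρ (z n)).im) : False := by
  obtain ⟨N, hN⟩ := eventually_atTop.1 hcone
  exact no_infty S hx hδ (z := fun n => z (n + N)) (hz.comp (tendsto_add_atTop_nat N)) (fun n => him _)
    (hM.comp (tendsto_add_atTop_nat N)) (fun n => hN _ (Nat.le_add_left _ _))

lemma yM_tendsto (ρ : Measure ℝ) [IsProbabilityMeasure ρ] {x : ℝ} (hx : 0 < x) :
    Tendsto (fun n : ℕ => ((1 / ((n : ℝ) + 1) : ℝ) : ℂ) * Mt ρ (x + ((1 / ((n : ℝ) + 1) : ℝ) : ℂ) * I)) atTop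
      (𝓝 ((ρ.real {t | x * t ^ 2 = 1} : ℂ) * (I * x))) := by
  have hA : MeasurableSet {t : ℝ | x * t ^ 2 = 1} := by
    exact measurableSet_eq_fun (by fun_prop) (by fun_prop)
  have h1 : ∀ n : ℕ, ((1 / ((n : ℝ) + 1) : ℝ) : ℂ) * Mt ρ (x + ((1 / ((n : ℝ) + 1) : ℝ) : ℂ) * I) =
    ∫ t : ℝ, ((1 / ((n : ℝ) + 1) : ℝ) : ℂ) * ((x + ((1 / ((n : ℝ) + 1) : ℝ) : ℂ) * I) * (t : ℂ) ^ 2 /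
       (1 - (x + ((1 / ((n : ℝ) + 1) : ℝ) : ℂ) * I) * (t : ℂ) ^ 2)) ∂ρ := by
    intro n; rw [integral_const_mul]; rfl
  have h2 : (ρ.real {t | x * t ^ 2 = 1} : ℂ) * (I * x) =
      ∫ t : ℝ, {t : ℝ | x * t ^ 2 = 1}.indicator (fun _ => I * x) t ∂ρ := by
    rw [integral_indicator hA, setIntegral_const]
    simp
  simp only [h1]
  rw [h2]
  have hy : Tendsto (fun n : ℕ => (1 / ((n : ℝ) + 1) : ℝ)) atTop (𝓝 0) := tendsto_one_div_add_atTop_nhds_zero_nat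
  have hyC : Tendsto (fun n : ℕ => ((1 / ((n : ℝ) + 1) : ℝ) : ℂ)) atTop (𝓝 0) := by
    have := (Complex.continuous_ofReal.tendsto 0).comp hy
    rw [Complex.ofReal_zero] at this; exact this
  have hzC : Tendsto (fun n : ℕ => (x : ℂ) + ((1 / ((n : ℝ) + 1) : ℝ) : ℂ) * I) atTop (𝓝 (x : ℂ)) := by
    have := (hyC.mul_const I).const_add (x : ℂ)
    simpa using this
  refine tendsto_integral_of_dominated_convergence (fun _ => x + 1) ?_ (integrable_const _) ?_ ?_
  · intro n
    apply Measurable.aestronglyMeasurable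
    fun_prop
  · intro n
    refine Eventually.of_forall fun t => ?_
    have hyp : (0 : ℝ) < 1 / ((n : ℝ) + 1) := by positivity
    have hy1 : 1 / ((n : ℝ) + 1) ≤ 1 := by
      rw [div_le_one (by positivity)]; have : (0 : ℝ) ≤ n := n.cast_nonneg; linarith
    generalize 1 / ((n : ℝ) + 1) = y at hyp hy1
    have a1 : ‖(x : ℂ) + y * I‖ ≤ x + 1 := by
      refine (norm_add_le _ _).trans ?_
      rw [norm_mul, Complex.norm_real, Complex.norm_real, Complex.norm_I, Real.norm_eq_abs, Real.norm_eq_abs,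
        abs_of_pos hx, abs_of_pos hyp]
      linarith
    have a2 : y * t ^ 2 ≤ ‖1 - ((x : ℂ) + y * I) * (t : ℂ) ^ 2‖ := by
      have := Complex.abs_im_le_norm (1 - ((x : ℂ) + y * I) * (t : ℂ) ^ 2)
      have e : (1 - ((x : ℂ) + y * I) * (t : ℂ) ^ 2).im = - (y * t ^ 2) := by
        rw [← Complex.ofReal_pow]; simp [-ofReal_pow]
      rw [e, abs_neg, abs_of_nonneg (by positivity)] at this
      exact this
    rw [norm_mul, norm_div, norm_mul, norm_pow, Complex.norm_real, Complex.norm_real, Real.norm_eq_abs, Real.norm_eq_abs,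
       abs_of_pos hyp, sq_abs, mul_div_assoc', ]
    apply div_le_of_le_mul₀ (norm_nonneg _) (by positivity)
    calc y * (‖(x : ℂ) + y * I‖ * t ^ 2) = ‖(x : ℂ) + y * I‖ * (y * t ^ 2) := by ring
      _ ≤ (x + 1) * ‖1 - ((x : ℂ) + y * I) * (t : ℂ) ^ 2‖ := by
        apply mul_le_mul a1 a2 (by positivity) (by positivity)
  · refine Eventually.of_forall fun t => ?_
    by_cases ht : x * t ^ 2 = 1
    · rw [indicator_of_mem (show t ∈ {t : ℝ | x * t ^ 2 = 1} from ht)]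
      have ht0 : t ≠ 0 := by rintro rfl; simp at ht
      have htC : (t : ℂ) ≠ 0 := by exact_mod_cast ht0
      have hxt : (x : ℂ) * (t : ℂ) ^ 2 = 1 := by exact_mod_cast ht
      have := hzC.const_mul I
      refine this.congr fun n => ?_
      have hyp : (1 / ((n : ℝ) + 1) : ℝ) ≠ 0 := by positivity
      generalize (1 / ((n : ℝ) + 1) : ℝ) = y at hyp
      have hyC : (y : ℂ) ≠ 0 := by exact_mod_cast hyp
      have e : 1 - ((x : ℂ) + y * I) * (t : ℂ) ^ 2 = - (y * (t : ℂ) ^ 2 * I) := by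
        linear_combination (-1) * hxt
      rw [e]
      have : I ≠ 0 := I_ne_zero
      rw [eq_comm, mul_div_assoc', div_eq_iff (by simp [hyC, htC])]
      linear_combination (y * (t : ℂ) ^ 2 * (y * I + x)) * I_sq
    · rw [indicator_of_notMem (show t ∉ {t : ℝ | x * t ^ 2 = 1} from ht)]
      have hne : 1 - (x : ℂ) * (t : ℂ) ^ 2 ≠ 0 := by
        intro h0
        apply ht
        have : (x : ℂ) * (t : ℂ) ^ 2 = 1 := by linear_combination -h0
        exact_mod_cast this
      have := hyC.mul ((hzC.mul_const ((t : ℂ) ^ 2)).div ((hzC.mul_const ((t : ℂ) ^ 2)).const_sub 1) hne)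
      simpa using this

theorem no_atoms (S : SubS l G ν ρ) (t0 : ℝ) : ρ {t0} = 0 := by
  rcases eq_or_ne t0 0 with rfl | h0
  · exact rho_zero S
  by_contra hne
  set x := 1 / t0 ^ 2 with hx
  have hxpos : 0 < x := by positivity
  set A := ρ.real {t | x * t ^ 2 = 1} with hA
  have hApos : 0 < A := by
    refine ENNReal.toReal_pos (fun h => hne (measure_mono_null ?_ h)) (measure_ne_top _ _)
    intro t ht
    rw [mem_singleton_iff] at ht
    subst ht
    simp only [Set.mem_ofPred_eq, hx]
    field_simp
  have hlim := yM_tendsto ρ hxpos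
  rw [← hA] at hlim
  set y : ℕ → ℝ := fun n => 1 / ((n : ℝ) + 1) with hy
  have hyp : ∀ n, 0 < y n := fun n => by simp only [hy]; positivity
  have hyt : Tendsto y atTop (𝓝 0) := tendsto_one_div_add_atTop_nhds_zero_nat
  set z : ℕ → ℂ := fun n => x + (y n : ℂ) * I with hz
  change Tendsto (fun n => (y n : ℂ) * Mt ρ (z n)) atTop (𝓝 ((A : ℂ) * (I * x))) at hlim
  have hk : 0 < A * x := mul_pos hApos hxpos
  have hnorm : Tendsto (fun n => y n * ‖Mt ρ (z n)‖) atTop (𝓝 (A * x)) := by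
    have := hlim.norm
    simp only [norm_mul, Complex.norm_real, Complex.norm_I, one_mul, Real.norm_eq_abs, abs_of_pos hApos,
      abs_of_pos hxpos] at this
    refine this.congr fun n => ?_
    rw [abs_of_pos (hyp n)]
  have himt : Tendsto (fun n => y n * (Mt ρ (z n)).im) atTop (𝓝 (A * x)) := by
    have := (Complex.continuous_im.tendsto _).comp hlim
    have e : ((A : ℂ) * (I * x)).im = A * x := by simp
    rw [e] at this
    refine this.congr fun n => ?_
    simp only [Function.comp, Complex.im_ofReal_mul]
  refine no_infty' S hxpos (δ := 1 / 4) (by norm_num) (z := z) ?_ ?_ ?_ ?_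
  · have h1 : Tendsto (fun n => (y n : ℂ)) atTop (𝓝 0) := by
      have := (Complex.continuous_ofReal.tendsto 0).comp hyt
      rw [Complex.ofReal_zero] at this; exact this
    have := (h1.mul_const I).const_add (x : ℂ)
    simpa using this
  · intro n; simp [hz, hyp n]
  · have hinv : Tendsto (fun n => (y n)⁻¹) atTop atTop := by
      apply Tendsto.inv_tendsto_nhdsGT_zero
      exact tendsto_nhdsWithin_of_tendsto_nhds_of_eventually_within _ hyt (Eventually.of_forall hyp)
    have := hnorm.pos_mul_atTop hk hinv
    refine this.congr fun n => ?_
    have := (hyp n).ne'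
    field_simp
  · filter_upwards [hnorm.eventually (gt_mem_nhds (show A * x < 2 * (A * x) by linarith)),
      himt.eventually (lt_mem_nhds (show A * x / 2 < A * x by linarith))] with n a b
    have := hyp n
    by_contra hc
    push Not at hc
    nlinarith
end

section

def Gt (ρ : Measure ℝ) (w : ℂ) : ℂ := ∫ t : ℝ, ((t : ℂ) - w)⁻¹ ∂ρ

lemma sub_ne_of_im {w : ℂ} (hw : 0 < w.im) (t : ℝ) : (t : ℂ) - w ≠ 0 := by
  intro h
  have := congrArg Complex.im h
  simp at this
  linarith

lemma norm_inv_le_im {w : ℂ} (hw : 0 < w.im) (t : ℝ) : ‖((t : ℂ) - w)⁻¹‖ ≤ 1 / w.im := by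
  rw [norm_inv, ← one_div]
  apply one_div_le_one_div_of_le hw
  have := Complex.abs_im_le_norm ((t : ℂ) - w)
  simp only [Complex.sub_im, Complex.ofReal_im, zero_sub, abs_neg, abs_of_pos hw] at this
  exact this

lemma Gt_integrable (ρ : Measure ℝ) [IsFiniteMeasure ρ] {w : ℂ} (hw : 0 < w.im) :
    Integrable (fun t : ℝ => ((t : ℂ) - w)⁻¹) ρ := by
  refine Integrable.of_bound (Measurable.aestronglyMeasurable (by fun_prop)) (1 / w.im)
    (Eventually.of_forall fun t => norm_inv_le_im hw t)

lemma Gt_norm_le (ρ : Measure ℝ) [IsProbabilityMeasure ρ] {w : ℂ} (hw : 0 < w.im) :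
    ‖Gt ρ w‖ ≤ 1 / w.im := by
  have := norm_integral_le_of_norm_le_const (μ := ρ) (Eventually.of_forall fun t => norm_inv_le_im hw t)
  simpa [Gt] using this

lemma inv_im_eq (t u y : ℝ) : (((t : ℂ) - (u + y * I))⁻¹).im = y / ((t - u) ^ 2 + y ^ 2) := by
  rw [Complex.inv_im, Complex.normSq_apply]
  simp
  ring

lemma Gt_im (ρ : Measure ℝ) [IsFiniteMeasure ρ] {u y : ℝ} (hy : 0 < y) :
    (Gt ρ (u + y * I)).im = ∫ t : ℝ, y / ((t - u) ^ 2 + y ^ 2) ∂ρ := by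
  have h := Gt_integrable ρ (w := u + y * I) (by simpa using hy)
  have : (Gt ρ (u + y * I)).im = ∫ t : ℝ, (((t : ℂ) - (u + y * I))⁻¹).im ∂ρ := by
    rw [Gt]
    exact (integral_im h).symm
  rw [this]
  simp only [inv_im_eq]

lemma pois_integrable (ρ : Measure ℝ) [IsFiniteMeasure ρ] {u y : ℝ} (hy : 0 < y) :
    Integrable (fun t : ℝ => y / ((t - u) ^ 2 + y ^ 2)) ρ := by
  have h := (Gt_integrable ρ (w := u + y * I) (by simpa using hy)).im
  refine h.congr (Eventually.of_forall fun t => ?_)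
  exact inv_im_eq t u y

lemma Gt_im_nonneg (ρ : Measure ℝ) [IsFiniteMeasure ρ] {u y : ℝ} (hy : 0 < y) :
    0 ≤ (Gt ρ (u + y * I)).im := by
  rw [Gt_im ρ hy]
  exact integral_nonneg fun t => by positivity

lemma Gt_im_lower (ρ : Measure ℝ) [IsFiniteMeasure ρ] {u y : ℝ} (hy : 0 < y) :
    ρ.real (Metric.closedBall u y) / (2 * y) ≤ (Gt ρ (u + y * I)).im := by
  rw [Gt_im ρ hy]
  calc ρ.real (Metric.closedBall u y) / (2 * y) = ∫ t in Metric.closedBall u y, 1 / (2 * y) ∂ρ := by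
        rw [setIntegral_const]; simp [div_eq_mul_inv]
    _ ≤ ∫ t in Metric.closedBall u y, y / ((t - u) ^ 2 + y ^ 2) ∂ρ := by
        refine setIntegral_mono_on (integrable_const _) (pois_integrable ρ hy).integrableOn
          Metric.isClosed_closedBall.measurableSet ?_
        intro t ht
        rw [Metric.mem_closedBall, Real.dist_eq] at ht
        have : (t - u) ^ 2 ≤ y ^ 2 := by
          rw [← sq_abs]; exact pow_le_pow_left₀ (abs_nonneg _) ht 2
        rw [div_le_div_iff₀ (by positivity) (by positivity)]
        nlinarith
    _ ≤ _ := setIntegral_le_integral (pois_integrable ρ hy) (Eventually.of_forall fun t => by positivity)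

lemma N1 (ρ : Measure ℝ) [IsFiniteMeasure ρ] :
    ∀ᵐ t : ℝ ∂ρ, ∃ c > 0, ∀ᶠ y : ℝ in 𝓝[>] (0 : ℝ), c ≤ (Gt ρ (t + y * I)).im := by
  filter_upwards [Besicovitch.ae_tendsto_rnDeriv (volume : Measure ℝ) ρ, Measure.rnDeriv_lt_top volume ρ]
    with t ht hfin
  obtain ⟨A, hA1, hA2⟩ := ENNReal.lt_iff_exists_nnreal_btwn.1 hfin
  have hApos : 0 < A := by
    have : (0 : ENNReal) < A := lt_of_le_of_lt zero_le hA1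
    exact_mod_cast this
  refine ⟨1 / A, by positivity, ?_⟩
  filter_upwards [ht.eventually (gt_mem_nhds hA1), self_mem_nhdsWithin] with y hy hy0
  have hy0 : 0 < y := hy0
  refine le_trans ?_ (Gt_im_lower ρ hy0)
  rw [Real.volume_closedBall] at hy
  have h0 : ρ (Metric.closedBall t y) ≠ 0 := by
    intro h0
    rw [h0, ENNReal.div_zero (by simpa using hy0)] at hy
    exact absurd hy (by simp)
  have := (ENNReal.div_le_iff h0 (measure_ne_top _ _)).1 hy.le
  have h2 := ENNReal.toReal_mono (by finiteness) this
  rw [ENNReal.toReal_ofReal (by positivity), ENNReal.toReal_mul, ENNReal.coe_toReal] at h2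
  change 2 * y ≤ A * ρ.real _ at h2
  rw [div_le_div_iff₀ (by exact_mod_cast hApos) (by positivity)]
  linarith

variable {ρ : Measure ℝ} [IsProbabilityMeasure ρ]

open scoped ComplexOrder in
lemma inv_sq_slit {w : ℂ} (hw : 0 < w.im) : 1 / w ^ 2 ∈ slit := by
  have hne : w ≠ 0 := by rintro rfl; simp at hw
  by_contra h
  have h1 : ‖1 / w ^ 2‖ ≤ (1 / w ^ 2).re := not_lt.1 h
  have h2 : (1 / w ^ 2).re = ‖1 / w ^ 2‖ := le_antisymm (Complex.re_le_norm _) h1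
  rw [Complex.re_eq_norm] at h2
  have h3 : 0 ≤ w ^ 2 := by
    have : 0 ≤ (1 / w ^ 2)⁻¹ := by
      rw [Complex.nonneg_iff] at h2 ⊢
      rw [Complex.inv_re, Complex.inv_im, ← h2.2]
      exact ⟨div_nonneg h2.1 (Complex.normSq_nonneg _), by simp⟩
    simpa using this
  rw [Complex.nonneg_iff] at h3
  have e1 : (w ^ 2).re = w.re ^ 2 - w.im ^ 2 := by rw [sq]; simp; ring
  have e2 : (w ^ 2).im = 2 * w.re * w.im := by rw [sq]; simp; ring
  rw [e1, e2] at h3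
  have : w.re = 0 := by
    have := h3.2.symm
    rcases mul_eq_zero.1 this with h | h
    · linarith
    · exact absurd h hw.ne'
  rw [this] at h3
  nlinarith [h3.1]

lemma Gt_symm (hs : Measure.map (fun t : ℝ => -t) ρ = ρ) {w : ℂ} (hw : 0 < w.im) :
    1 + Mt ρ (1 / w ^ 2) = - w * Gt ρ w := by
  have hne : w ≠ 0 := by rintro rfl; simp at hw
  have h1 : Gt ρ w = ∫ t : ℝ, (-(t : ℂ) - w)⁻¹ ∂ρ := by
    conv_lhs => rw [Gt, ← hs]
    rw [integral_map (by fun_prop) (Measurable.aestronglyMeasurable (by fun_prop))]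
    simp
  have hi1 := Gt_integrable ρ hw
  have hn2 : ∀ t : ℝ, -(t : ℂ) - w ≠ 0 := fun t => by
    have := sub_ne_of_im hw (-t); simpa using this
  have hi2 : Integrable (fun t : ℝ => (-(t : ℂ) - w)⁻¹) ρ := by
    refine Integrable.of_bound (Measurable.aestronglyMeasurable (by fun_prop)) (1 / w.im)
      (Eventually.of_forall fun t => ?_)
    have := norm_inv_le_im hw (-t); simpa using this
  have h2 : - w * Gt ρ w = ∫ t : ℝ, (-w / 2) * (((t : ℂ) - w)⁻¹ + (-(t : ℂ) - w)⁻¹) ∂ρ := by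
    rw [integral_const_mul, integral_add hi1 hi2, ← h1]
    simp only [Gt]; ring
  have hz := inv_sq_slit hw
  rw [h2]
  have h3 : (1 : ℂ) + Mt ρ (1 / w ^ 2) =
      ∫ t : ℝ, (1 + (1 / w ^ 2) * (t : ℂ) ^ 2 / (1 - (1 / w ^ 2) * (t : ℂ) ^ 2)) ∂ρ := by
    have key : ∀ t : ℝ, (1 / w ^ 2) * (t : ℂ) ^ 2 / (1 - (1 / w ^ 2) * (t : ℂ) ^ 2) =
       (-w / 2) * (((t : ℂ) - w)⁻¹ + (-(t : ℂ) - w)⁻¹) - 1 := by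
      intro t
      have a := sub_ne_of_im hw t
      have b := hn2 t
      have c : 1 - (1 / w ^ 2) * (t : ℂ) ^ 2 = ((t : ℂ) - w) * (-(t : ℂ) - w) / w ^ 2 := by
        field_simp; ring
      rw [c]
      field_simp
      ring
    rw [integral_add (integrable_const _)]
    · simp [Mt]
    · simp only [key]
      exact ((hi1.add hi2).const_mul _).sub (integrable_const _)
  rw [h3]
  congr 1
  ext t
  have a := sub_ne_of_im hw t
  have b := hn2 t
  have c : 1 - (1 / w ^ 2) * (t : ℂ) ^ 2 = ((t : ℂ) - w) * (-(t : ℂ) - w) / w ^ 2 := by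
    field_simp; ring
  rw [c]
  field_simp
  ring

lemma Gt_diff (hs : Measure.map (fun t : ℝ => -t) ρ = ρ) {w : ℂ} (hw : 0 < w.im) :
    DifferentiableAt ℂ (Gt ρ) w := by
  have hne : w ≠ 0 := by rintro rfl; simp at hw
  have hM : DifferentiableAt ℂ (Mt ρ) (1 / w ^ 2) := (Mt_an ρ (inv_sq_slit hw)).differentiableAt
  have h1 : DifferentiableAt ℂ (fun v : ℂ => 1 / v ^ 2) w := by
    refine DifferentiableAt.div (by fun_prop) (by fun_prop) (by simpa using hne)
  have h2 : DifferentiableAt ℂ (fun v : ℂ => -(1 + Mt ρ (1 / v ^ 2)) / v) w :=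
    ((hM.comp w h1).const_add 1).neg.div differentiableAt_id hne
  refine h2.congr_of_eventuallyEq ?_
  have : ∀ᶠ v in 𝓝 w, 0 < v.im := continuous_im.continuousAt.eventually (lt_mem_nhds hw)
  filter_upwards [this] with v hv
  have hv0 : v ≠ 0 := by rintro rfl; simp at hv
  rw [Gt_symm hs hv]
  field_simp

end

section
variable {ρ : Measure ℝ} [IsProbabilityMeasure ρ]

lemma Gt_cont_line (hs : Measure.map (fun t : ℝ => -t) ρ = ρ) {y : ℝ} (hy : 0 < y) :
    Continuous (fun x : ℝ => Gt ρ (x + y * I)) := by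
  rw [continuous_iff_continuousAt]
  intro x
  have h := (Gt_diff hs (w := x + y * I) (by simpa using hy)).continuousAt
  have h2 : ContinuousAt (fun x : ℝ => (x : ℂ) + y * I) x := by fun_prop
  exact ContinuousAt.comp (g := Gt ρ) (f := fun x : ℝ => (x : ℂ) + y * I) h h2

lemma re_one_add_sq (g : ℂ) (h0 : 0 ≤ g.im) (h : g.im ≤ 1 / 4 * (1 + ‖g‖)) :
    3 / 4 * ‖g‖ ^ 2 ≤ (1 + g ^ 2).re := by
  have e : (1 + g ^ 2).re = 1 + ‖g‖ ^ 2 - 2 * g.im ^ 2 := by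
    rw [Complex.sq_norm, Complex.normSq_apply]; rw [sq]; simp; ring
  rw [e]
  have : g.im ^ 2 ≤ (1 / 4 * (1 + ‖g‖)) ^ 2 := pow_le_pow_left₀ h0 h 2
  nlinarith [sq_nonneg (1 - ‖g‖)]

lemma nsq (x y a : ℝ) : ‖((x : ℂ) + y * I - a) ^ 2‖ = (x - a) ^ 2 + y ^ 2 := by
  rw [norm_pow, Complex.sq_norm, Complex.normSq_apply]; simp; ring

lemma one_add_Gsq_norm {w : ℂ} (hw : 0 < w.im) : ‖1 + Gt ρ w ^ 2‖ ≤ 1 + 1 / w.im ^ 2 := by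
  refine (norm_add_le _ _).trans ?_
  rw [norm_one, norm_pow]
  have := pow_le_pow_left₀ (norm_nonneg _) (Gt_norm_le ρ hw) 2
  rw [div_pow, one_pow] at this
  linarith

lemma N2 (hs : Measure.map (fun t : ℝ => -t) ρ = ρ) {a b Y : ℝ} (hab : a < b) (hY : 0 < Y)
    (hbad : ∀ x ∈ Icc a b, ∀ y ∈ Ioc 0 Y,
      (Gt ρ (x + y * I)).im ≤ 1 / 4 * (1 + ‖Gt ρ (x + y * I)‖)) :
    ∃ K : ℝ, ∀ ε ∈ Ioc 0 (Y / 2),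
      ∫ x in a..b, ‖Gt ρ (x + ε * I)‖ ^ 2 * ((x - a) ^ 2 * (x - b) ^ 2) ≤ K := by
  set h := Y / 2 with hh
  have hhpos : 0 < h := by positivity
  set R := (b - a) ^ 2 + h ^ 2 with hR
  have hRpos : 0 < R := by positivity
  set K1 := (1 + 1 / h ^ 2) * (R * R) with hK1
  set K2 := (h ^ 2 + 1) * R with hK2
  refine ⟨4 / 3 * (K1 * (b - a) + K2 * h + K2 * h), fun ε hε => ?_⟩
  obtain ⟨hε0, hεh⟩ := hε
  set N : ℂ → ℂ := fun ζ => (1 + Gt ρ (ζ + ε * I) ^ 2) * ((ζ - a) ^ 2 * (ζ - b) ^ 2) with hN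
  have himp : ∀ x y : ℝ, ((x : ℂ) + y * I + ε * I).im = y + ε := fun x y => by simp
  have hdiff : ∀ ζ : ℂ, 0 ≤ ζ.im → DifferentiableAt ℂ N ζ := by
    intro ζ hζ
    have h1 : DifferentiableAt ℂ (Gt ρ) (ζ + ε * I) := Gt_diff hs (by simp; linarith)
    have h2 : DifferentiableAt ℂ (fun ζ : ℂ => Gt ρ (ζ + ε * I)) ζ :=
      DifferentiableAt.comp (g := Gt ρ) (f := fun ζ : ℂ => ζ + ε * I) ζ h1 (by fun_prop)
    simp only [hN]
    fun_prop
  have cauchy := Complex.integral_boundary_rect_eq_zero_of_differentiableOn N (a : ℂ) (b + h * I) (by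
    intro ζ hζ
    apply (hdiff ζ _).differentiableWithinAt
    rw [Complex.mem_reProdIm] at hζ
    have := hζ.2
    simp only [ofReal_im, add_im, mul_im, ofReal_re, I_im, mul_one, I_re, mul_zero, add_zero, zero_add] at this
    rw [uIcc_of_le hhpos.le] at this
    exact this.1)
  have e1 : ((b : ℂ) + h * I).re = b := by simp
  have e2 : ((b : ℂ) + h * I).im = h := by simp
  rw [e1, e2, ofReal_re, ofReal_im] at cauchy
  have nb : ∀ x ∈ Icc a b, ∀ y ∈ Icc 0 h, (x - a) ^ 2 + y ^ 2 ≤ R ∧ (x - b) ^ 2 + y ^ 2 ≤ R := by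
    intro x hx y hy
    have := hx.1; have := hx.2; have := hy.1; have := hy.2
    simp only [hR]
    constructor <;> nlinarith
  -- top
  have top : ‖∫ x in a..b, N (x + h * I)‖ ≤ K1 * |b - a| := by
    refine intervalIntegral.norm_integral_le_of_norm_le_const fun x hx => ?_
    rw [uIoc_of_le hab.le] at hx
    have hx' : x ∈ Icc a b := Ioc_subset_Icc_self hx
    obtain ⟨r1, r2⟩ := nb x hx' h ⟨hhpos.le, le_rfl⟩
    simp only [hN, norm_mul, nsq]
    have i1 : 0 < ((x : ℂ) + h * I + ε * I).im := by rw [himp]; linarith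
    have := one_add_Gsq_norm (ρ := ρ) i1
    rw [himp] at this
    have i2 : 1 / (h + ε) ^ 2 ≤ 1 / h ^ 2 := by
      apply one_div_le_one_div_of_le (by positivity); gcongr; linarith
    simp only [hK1]
    gcongr
    linarith
  have sideb : ∀ y ∈ Icc 0 h, ‖1 + Gt ρ (a + y * I + ε * I) ^ 2‖ * y ^ 2 ≤ h ^ 2 + 1 ∧
     ‖1 + Gt ρ (b + y * I + ε * I) ^ 2‖ * y ^ 2 ≤ h ^ 2 + 1 := by
    intro y hy
    have hy0 := hy.1
    have k : (1 + 1 / (y + ε) ^ 2) * y ^ 2 ≤ h ^ 2 + 1 := by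
      have : 1 / (y + ε) ^ 2 * y ^ 2 ≤ 1 := by
        rw [one_div, ← div_eq_inv_mul, div_le_one (by positivity)]; gcongr; linarith
      have : y ^ 2 ≤ h ^ 2 := by have := hy.2; gcongr
      linarith
    constructor
    · have := one_add_Gsq_norm (ρ := ρ) (w := a + y * I + ε * I) (by rw [himp]; linarith)
      rw [himp] at this
      refine le_trans ?_ k
      gcongr
    · have := one_add_Gsq_norm (ρ := ρ) (w := b + y * I + ε * I) (by rw [himp]; linarith)
      rw [himp] at this
      refine le_trans ?_ k
      gcongr
  have side1 : ‖∫ y in (0 : ℝ)..h, N (a + y * I)‖ ≤ K2 * |h - 0| := by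
    refine intervalIntegral.norm_integral_le_of_norm_le_const fun y hy => ?_
    rw [uIoc_of_le hhpos.le] at hy
    have hy' : y ∈ Icc 0 h := Ioc_subset_Icc_self hy
    obtain ⟨r1, r2⟩ := nb a ⟨le_rfl, hab.le⟩ y hy'
    have s := (sideb y hy').1
    simp only [hN, norm_mul, nsq]
    rw [sub_self, ← mul_assoc]
    simp only [hK2]
    gcongr
    simpa using s
  have side2 : ‖∫ y in (0 : ℝ)..h, N (b + y * I)‖ ≤ K2 * |h - 0| := by
    refine intervalIntegral.norm_integral_le_of_norm_le_const fun y hy => ?_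
    rw [uIoc_of_le hhpos.le] at hy
    have hy' : y ∈ Icc 0 h := Ioc_subset_Icc_self hy
    obtain ⟨r1, r2⟩ := nb b ⟨hab.le, le_rfl⟩ y hy'
    have s := (sideb y hy').2
    simp only [hN, norm_mul, nsq]
    rw [sub_self, mul_comm ((b - a) ^ 2 + y ^ 2), ← mul_assoc]
    simp only [hK2]
    gcongr
    simpa using s
  rw [abs_of_pos (by linarith)] at top
  rw [sub_zero, abs_of_pos hhpos] at side1 side2
  have bottom : ‖∫ x in a..b, N (x + (0 : ℝ) * I)‖ ≤ K1 * (b - a) + K2 * h + K2 * h := by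
    have : ∫ x in a..b, N (x + (0 : ℝ) * I) = (∫ x in a..b, N (x + h * I)) -
       I * (∫ y in (0 : ℝ)..h, N (b + y * I)) + I * (∫ y in (0 : ℝ)..h, N (a + y * I)) := by
      simp only [smul_eq_mul] at cauchy
      linear_combination cauchy
    rw [this]
    refine (norm_add_le _ _).trans ?_
    have := norm_sub_le (∫ x in a..b, N (x + h * I)) (I * (∫ y in (0 : ℝ)..h, N (b + y * I)))
    rw [norm_mul, Complex.norm_I, one_mul] at this
    rw [norm_mul, Complex.norm_I, one_mul]
    linarith
  have hNc : Continuous (fun x : ℝ => N (x + (0 : ℝ) * I)) := by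
    have := Gt_cont_line hs hε0
    simp only [hN, ofReal_zero, zero_mul, add_zero]
    fun_prop
  have hre : (∫ x in a..b, N (x + (0 : ℝ) * I)).re = ∫ x in a..b, (N (x + (0 : ℝ) * I)).re :=
    (Complex.reCLM.intervalIntegral_comp_comm (hNc.intervalIntegrable a b)).symm
  have hle : (3 / 4 : ℝ) * ∫ x in a..b, ‖Gt ρ (x + ε * I)‖ ^ 2 * ((x - a) ^ 2 * (x - b) ^ 2) ≤
      ∫ x in a..b, (N (x + (0 : ℝ) * I)).re := by
    rw [← intervalIntegral.integral_const_mul]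
    refine intervalIntegral.integral_mono_on hab.le ?_ ?_ ?_
    · have := Gt_cont_line hs hε0
      exact Continuous.intervalIntegrable (by fun_prop) _ _
    · exact (Complex.continuous_re.comp hNc).intervalIntegrable _ _
    · intro x hx
      have e : N (x + (0 : ℝ) * I) = (((x - a) ^ 2 * (x - b) ^ 2 : ℝ) : ℂ) * (1 + Gt ρ (x + ε * I) ^ 2) := by
        simp only [hN, ofReal_zero, zero_mul, add_zero]; push_cast; ring
      rw [e, Complex.re_ofReal_mul]
      have := re_one_add_sq _ (Gt_im_nonneg ρ hε0) (hbad x hx ε ⟨hε0, by linarith⟩)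
      have q : 0 ≤ (x - a) ^ 2 * (x - b) ^ 2 := by positivity
      nlinarith [mul_le_mul_of_nonneg_left this q]
  have := (Complex.abs_re_le_norm _).trans bottom
  rw [hre] at this
  have := (le_abs_self _).trans this
  linarith

lemma N2' (hs : Measure.map (fun t : ℝ => -t) ρ = ρ) {a b a' b' Y : ℝ} (ha : a < a') (hab' : a' < b') (hb : b' < b)
    (hY : 0 < Y)
    (hbad : ∀ x ∈ Icc a b, ∀ y ∈ Ioc 0 Y,
      (Gt ρ (x + y * I)).im ≤ 1 / 4 * (1 + ‖Gt ρ (x + y * I)‖)) :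
    ∃ K : NNReal, ∀ ε ∈ Ioc 0 (Y / 2),
      ∫⁻ x in Ioo a' b', ENNReal.ofReal (‖Gt ρ (x + ε * I)‖ ^ 2) ≤ K := by
  obtain ⟨K, hK⟩ := N2 hs (show a < b by linarith) hY hbad
  set q := (a' - a) ^ 2 * (b - b') ^ 2 with hq
  have hqpos : 0 < q := by
    have : 0 < a' - a := by linarith
    have : 0 < b - b' := by linarith
    positivity
  refine ⟨Real.toNNReal (K / q), fun ε hε => ?_⟩
  have hc := Gt_cont_line hs hε.1
  have hci : Continuous (fun x : ℝ => ‖Gt ρ (x + ε * I)‖ ^ 2) := by fun_prop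
  have hint : IntegrableOn (fun x : ℝ => ‖Gt ρ (x + ε * I)‖ ^ 2) (Ioo a' b') :=
    (hci.integrableOn_Icc (a := a') (b := b')).mono_set Ioo_subset_Icc_self
  rw [← ofReal_integral_eq_lintegral_ofReal hint (Eventually.of_forall fun x => by positivity)]
  change _ ≤ ENNReal.ofReal _
  apply ENNReal.ofReal_le_ofReal
  rw [le_div_iff₀ hqpos]
  refine le_trans ?_ (hK ε hε)
  rw [intervalIntegral.integral_of_le (by linarith), ← integral_mul_const]
  have hci2 : Continuous (fun x : ℝ => ‖Gt ρ (x + ε * I)‖ ^ 2 * ((x - a) ^ 2 * (x - b) ^ 2)) := by fun_prop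
  have hint2 : IntegrableOn (fun x : ℝ => ‖Gt ρ (x + ε * I)‖ ^ 2 * ((x - a) ^ 2 * (x - b) ^ 2)) (Ioc a b) :=
    (hci2.integrableOn_Icc (a := a) (b := b)).mono_set Ioc_subset_Icc_self
  have hsub : Ioo a' b' ⊆ Ioc a b := fun x hx => ⟨by linarith [hx.1], by linarith [hx.2]⟩
  calc _ ≤ ∫ x in Ioo a' b', ‖Gt ρ (x + ε * I)‖ ^ 2 * ((x - a) ^ 2 * (x - b) ^ 2) := by
        refine setIntegral_mono_on (hint.mul_const _) (hint2.mono_set hsub) measurableSet_Ioo fun x hx => ?_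
        have h1 := hx.1
        have h2 := hx.2
        have : (b - b') ^ 2 ≤ (x - b) ^ 2 := by nlinarith
        have : (a' - a) ^ 2 ≤ (x - a) ^ 2 := by nlinarith
        simp only [hq]
        gcongr
    _ ≤ _ := setIntegral_mono_set hint2 (Eventually.of_forall fun x => by positivity) hsub.eventuallyLE

end

section
variable {ρ : Measure ℝ} [IsProbabilityMeasure ρ]

lemma eps_mem {h : ℝ} (hh : 0 < h) (n : ℕ) : h / ((n : ℝ) + 1) ∈ Ioc 0 h := by
  refine ⟨by positivity, div_le_self hh.le ?_⟩
  have : (0 : ℝ) ≤ n := n.cast_nonneg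
  linarith

lemma eps_tendsto (h : ℝ) : Tendsto (fun n : ℕ => h / ((n : ℝ) + 1)) atTop (𝓝 0) := by
  have := tendsto_one_div_add_atTop_nhds_zero_nat (𝕜 := ℝ) |>.const_mul h
  simpa [div_eq_mul_inv] using this

lemma N3 (hs : Measure.map (fun t : ℝ => -t) ρ = ρ) {J : Set ℝ} {h : ℝ} (hh : 0 < h) {K : NNReal}
    (hK : ∀ ε ∈ Ioc 0 h, ∫⁻ x in J, ENNReal.ofReal (‖Gt ρ (x + ε * I)‖ ^ 2) ≤ K) :
    ∀ᵐ x : ℝ ∂(volume.restrict J), ¬ Tendsto (fun n : ℕ => ‖Gt ρ (x + (h / ((n : ℝ) + 1) : ℝ) * I)‖) atTop atTop := by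
  set f : ℕ → ℝ → ENNReal := fun n x => ENNReal.ofReal (‖Gt ρ (x + (h / ((n : ℝ) + 1) : ℝ) * I)‖ ^ 2) with hf
  have hm : ∀ n, Measurable (f n) := fun n => by
    have := (Gt_cont_line hs (eps_mem hh n).1)
    exact (ENNReal.continuous_ofReal.comp (by fun_prop)).measurable
  have h1 : ∫⁻ x in J, liminf (fun n => f n x) atTop ≤ K := by
    refine (lintegral_liminf_le hm).trans ?_
    exact liminf_le_of_frequently_le' (Frequently.of_forall fun n => hK _ (eps_mem hh n))
  have h2 := ae_lt_top (.liminf hm) (lt_of_le_of_lt h1 ENNReal.coe_lt_top).ne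
  filter_upwards [h2] with x hx ht
  have : Tendsto (fun n => f n x) atTop (𝓝 ⊤) := by
    apply ENNReal.tendsto_ofReal_nhds_top.2
    exact (tendsto_pow_atTop (two_ne_zero)).comp ht
  rw [this.liminf_eq] at hx
  exact lt_irrefl _ hx

lemma pois_lower {W : Set ℝ} (hW : IsOpen W) {t : ℝ} (ht : t ∈ W) {h : ℝ} (hh : 0 < h) :
    ∀ᶠ n : ℕ in atTop, 1 ≤ ∫⁻ r in W, ENNReal.ofReal
      ((h / ((n : ℝ) + 1)) / ((t - r) ^ 2 + (h / ((n : ℝ) + 1)) ^ 2)) := by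
  obtain ⟨δ, hδ, hb⟩ := Metric.isOpen_iff.1 hW t ht
  filter_upwards [(eps_tendsto h).eventually (gt_mem_nhds hδ)] with n hn
  have h0 := (eps_mem hh n).1
  generalize h / ((n : ℝ) + 1) = y at hn h0
  have hsub : Metric.closedBall t y ⊆ W := (Metric.closedBall_subset_ball hn).trans hb
  calc (1 : ENNReal) = ∫⁻ r in Metric.closedBall t y, ENNReal.ofReal (1 / (2 * y)) := by
        rw [setLIntegral_const, Real.volume_closedBall, ← ENNReal.ofReal_mul (by positivity),
          one_div_mul_cancel (by positivity), ENNReal.ofReal_one]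
    _ ≤ ∫⁻ r in Metric.closedBall t y, ENNReal.ofReal (y / ((t - r) ^ 2 + y ^ 2)) := by
        refine setLIntegral_mono' Metric.isClosed_closedBall.measurableSet fun r hr => ?_
        apply ENNReal.ofReal_le_ofReal
        rw [Metric.mem_closedBall, Real.dist_eq] at hr
        have : (t - r) ^ 2 ≤ y ^ 2 := by
          rw [← sq_abs, abs_sub_comm]; exact pow_le_pow_left₀ (abs_nonneg _) hr 2
        rw [div_le_div_iff₀ (by positivity) (by positivity)]
        nlinarith
    _ ≤ _ := lintegral_mono_set hsub

lemma N4a (hs : Measure.map (fun t : ℝ => -t) ρ = ρ) {J : Set ℝ} {h : ℝ} (hh : 0 < h) {K : NNReal}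
    (hK : ∀ ε ∈ Ioc 0 h, ∫⁻ x in J, ENNReal.ofReal (‖Gt ρ (x + ε * I)‖ ^ 2) ≤ K)
    {W : Set ℝ} (hW : IsOpen W) (hWJ : W ⊆ J) {s : ℝ} (hs0 : 0 < s) :
    ρ W ≤ ENNReal.ofReal s * volume W + ENNReal.ofReal (1 / s) * K := by
  set k : ℕ → ℝ → ℝ → ENNReal := fun n t r => ENNReal.ofReal
      ((h / ((n : ℝ) + 1)) / ((t - r) ^ 2 + (h / ((n : ℝ) + 1)) ^ 2)) with hk
  have hkm : ∀ n, Measurable (Function.uncurry (k n)) := fun n => by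
    simp only [hk, Function.uncurry_def]; fun_prop
  have hkm2 : ∀ n, Measurable (fun t => ∫⁻ r in W, k n t r) := fun n =>
    (hkm n).lintegral_prod_right'
  have h1 : ρ W ≤ ∫⁻ t, liminf (fun n => ∫⁻ r in W, k n t r) atTop ∂ρ := by
    rw [← lintegral_indicator_one hW.measurableSet]
    refine lintegral_mono fun t => ?_
    by_cases ht : t ∈ W
    · rw [indicator_of_mem ht]
      exact le_liminf_of_le (by isBoundedDefault) (pois_lower hW ht hh)
    · rw [indicator_of_notMem ht]; exact zero_le
  refine h1.trans ((lintegral_liminf_le hkm2).trans ?_)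
  refine liminf_le_of_frequently_le' (Frequently.of_forall fun n => ?_)
  have hε := eps_mem hh n
  have hsw : ∫⁻ t, (∫⁻ r in W, k n t r) ∂ρ = ∫⁻ r in W, ∫⁻ t, k n t r ∂ρ :=
    lintegral_lintegral_swap (hkm n).aemeasurable
  rw [hsw]
  have hin : ∀ r : ℝ, ∫⁻ t, k n t r ∂ρ = ENNReal.ofReal ((Gt ρ (r + (h / ((n : ℝ) + 1) : ℝ) * I)).im) := by
    intro r
    rw [Gt_im ρ hε.1, ofReal_integral_eq_lintegral_ofReal (pois_integrable ρ hε.1)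
      (Eventually.of_forall fun t => by have := hε.1; positivity)]
  simp only [hin]
  have hc := Gt_cont_line hs hε.1
  have hK' := hK _ hε
  generalize h / ((n : ℝ) + 1) = y at *
  calc _ ≤ ∫⁻ r in W, (ENNReal.ofReal s + ENNReal.ofReal (1 / s) * ENNReal.ofReal (‖Gt ρ (r + y * I)‖ ^ 2)) := by
        refine lintegral_mono fun r => ?_
        rw [← ENNReal.ofReal_mul (by positivity), ← ENNReal.ofReal_add (by positivity) (by positivity)]
        apply ENNReal.ofReal_le_ofReal
        refine (le_abs_self _).trans ((Complex.abs_im_le_norm _).trans ?_)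
        have : 0 ≤ ‖Gt ρ (r + y * I)‖ := norm_nonneg _
        generalize ‖Gt ρ (r + y * I)‖ = g at this
        have : s + 1 / s * g ^ 2 - g = ((s - g) ^ 2 + s * g) / s := by field_simp; ring
        have : 0 ≤ ((s - g) ^ 2 + s * g) / s := by positivity
        linarith
    _ = ENNReal.ofReal s * volume W + ENNReal.ofReal (1 / s) * ∫⁻ r in W, ENNReal.ofReal (‖Gt ρ (r + y * I)‖ ^ 2) := by
        rw [lintegral_add_left measurable_const, setLIntegral_const, lintegral_const_mul']
        exact ENNReal.ofReal_ne_top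
    _ ≤ _ := by
        gcongr
        exact (lintegral_mono_set hWJ).trans hK'

lemma N4 (hs : Measure.map (fun t : ℝ => -t) ρ = ρ) {J : Set ℝ} (hJ : IsOpen J) {h : ℝ} (hh : 0 < h) {K : NNReal}
    (hK : ∀ ε ∈ Ioc 0 h, ∫⁻ x in J, ENNReal.ofReal (‖Gt ρ (x + ε * I)‖ ^ 2) ≤ K)
    {E : Set ℝ} (hE : E ⊆ J) (hE0 : volume E = 0) : ρ E = 0 := by
  have key : ∀ s : ℝ, 0 < s → ρ E ≤ ENNReal.ofReal (1 / s) * (1 + K) := by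
    intro s hs0
    have hpos : volume E < ENNReal.ofReal (1 / s * (1 / s)) := by rw [hE0]; rw [ENNReal.ofReal_pos]; positivity
    obtain ⟨W, hEW, hW, hlt⟩ := E.exists_isOpen_lt_of_lt _ hpos
    have := N4a hs hh hK (hW.inter hJ) inter_subset_right hs0
    refine (measure_mono (subset_inter hEW hE)).trans (this.trans ?_)
    rw [mul_add, mul_one]
    gcongr
    calc ENNReal.ofReal s * volume (W ∩ J) ≤ ENNReal.ofReal s * ENNReal.ofReal (1 / s * (1 / s)) := by
          gcongr
          exact (measure_mono inter_subset_left).trans hlt.le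
      _ = _ := by
        rw [← ENNReal.ofReal_mul hs0.le]
        congr 1
        field_simp
  have hlim : Tendsto (fun n : ℕ => ENNReal.ofReal (1 / ((n : ℝ) + 1)) * (1 + K)) atTop (𝓝 (0 * (1 + K))) := by
    refine ENNReal.Tendsto.mul_const ?_ (Or.inr (by finiteness))
    have := (ENNReal.continuous_ofReal.tendsto 0).comp (tendsto_one_div_add_atTop_nhds_zero_nat (𝕜 := ℝ))
    simpa [Function.comp_def] using this
  rw [zero_mul] at hlim
  exact le_antisymm (ge_of_tendsto' hlim fun n => key _ (by positivity)) zero_le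

lemma lemN (hs : Measure.map (fun t : ℝ => -t) ρ = ρ) :
    ∀ᵐ t : ℝ ∂ρ, ∃ δ > 0, ∃ᶠ w in 𝓝[UHP] (t : ℂ), δ * (1 + ‖Gt ρ w‖) ≤ (Gt ρ w).im := by
  set P : ℚ → ℕ → Prop := fun q k => ∀ x ∈ Icc ((q : ℝ) - 2 * (1 / ((k : ℝ) + 1))) (q + 2 * (1 / ((k : ℝ) + 1))),
     ∀ y ∈ Ioc (0 : ℝ) (1 / ((k : ℝ) + 1)),
      (Gt ρ (x + y * I)).im ≤ 1 / 4 * (1 + ‖Gt ρ (x + y * I)‖) with hP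
  have main : ∀ q k, P q k → ∀ᵐ t : ℝ ∂ρ, t ∈ Ioo ((q : ℝ) - (1 / ((k : ℝ) + 1))) (q + (1 / ((k : ℝ) + 1))) →
      ¬ Tendsto (fun n : ℕ => ‖Gt ρ (t + ((1 / ((k : ℝ) + 1) / 2) / ((n : ℝ) + 1) : ℝ) * I)‖) atTop atTop := by
    intro q k hPq
    have hk : 0 < 1 / ((k : ℝ) + 1) := by positivity
    simp only [hP] at hPq
    generalize 1 / ((k : ℝ) + 1) = r at *
    obtain ⟨K, hK⟩ := N2' hs (a' := q - r) (b' := q + r) (by linarith) (by linarith) (by linarith) hk hPq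
    have h3 := N3 hs (half_pos hk) hK
    rw [ae_restrict_iff' measurableSet_Ioo, ae_iff] at h3
    rw [ae_iff]
    refine N4 hs isOpen_Ioo (half_pos hk) hK ?_ h3
    intro t ht
    by_contra hcon
    exact ht fun h => absurd h hcon
  have main2 : ∀ᵐ t : ℝ ∂ρ, ∀ q k, P q k → t ∈ Ioo ((q : ℝ) - (1 / ((k : ℝ) + 1))) (q + (1 / ((k : ℝ) + 1))) →
      ¬ Tendsto (fun n : ℕ => ‖Gt ρ (t + ((1 / ((k : ℝ) + 1) / 2) / ((n : ℝ) + 1) : ℝ) * I)‖) atTop atTop := by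
    rw [ae_all_iff]; intro q
    rw [ae_all_iff]; intro k
    by_cases h : P q k
    · filter_upwards [main q k h] with t ht _ using ht
    · exact Eventually.of_forall fun t h' => absurd h' h
  filter_upwards [N1 ρ, main2] with t ⟨c, hc, hcy⟩ h2
  by_contra hcon
  push Not at hcon
  have h14 := hcon (1 / 4) (by norm_num)
  rw [eventually_nhdsWithin_iff, Metric.eventually_nhds_iff] at h14
  obtain ⟨r, hr, hball⟩ := h14
  obtain ⟨k, hk⟩ := exists_nat_one_div_lt (show 0 < r / 4 by positivity)
  have hkp : 0 < 1 / ((k : ℝ) + 1) := by positivity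
  obtain ⟨q, hq1, hq2⟩ := exists_rat_btwn (show t < t + 1 / ((k : ℝ) + 1) by linarith)
  refine h2 q k ?_ ⟨by linarith, by linarith⟩ ?_
  · intro x hx y hy
    generalize 1 / ((k : ℝ) + 1) = s at *
    refine (hball ?_ (show 0 < ((x : ℂ) + y * I).im by simpa using hy.1)).le
    rw [dist_eq_norm]
    have : (x : ℂ) + y * I - t = ((x - t : ℝ) : ℂ) + y * I := by push_cast; ring
    rw [this]
    refine lt_of_le_of_lt (norm_add_le _ _) ?_
    rw [norm_mul, Complex.norm_I, mul_one, Complex.norm_real, Complex.norm_real, Real.norm_eq_abs, Real.norm_eq_abs,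
      abs_of_pos hy.1]
    have : |x - t| ≤ 3 * s := by
      rw [abs_le]; constructor <;> linarith [hx.1, hx.2]
    linarith [hy.2]
  · have hh : 0 < 1 / ((k : ℝ) + 1) / 2 := by positivity
    generalize 1 / ((k : ℝ) + 1) / 2 = h at hh
    rw [tendsto_atTop]
    intro B
    set δ := c / (|B| + 2) with hδ
    have hδp : 0 < δ := by positivity
    have hd := hcon δ hδp
    have ht0 : Tendsto (fun n : ℕ => h / ((n : ℝ) + 1)) atTop (𝓝[>] 0) :=
      tendsto_nhdsWithin_of_tendsto_nhds_of_eventually_within _ (eps_tendsto h)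
        (Eventually.of_forall fun n => (eps_mem hh n).1)
    have htw : Tendsto (fun n : ℕ => (t : ℂ) + (h / ((n : ℝ) + 1) : ℝ) * I) atTop (𝓝[UHP] (t : ℂ)) := by
      refine tendsto_nhdsWithin_of_tendsto_nhds_of_eventually_within _ ?_ (Eventually.of_forall fun n => ?_)
      · have := (Complex.continuous_ofReal.tendsto 0).comp (eps_tendsto h)
        have := (this.mul_const I).const_add (t : ℂ)
        simpa [Function.comp_def] using this
      · show 0 < ((t : ℂ) + (h / ((n : ℝ) + 1) : ℝ) * I).im
        simpa only [Complex.add_im, Complex.ofReal_im, Complex.im_ofReal_mul, Complex.I_im, mul_one, zero_add] using (eps_mem hh n).1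
    filter_upwards [htw.eventually hd, ht0.eventually hcy] with n a b
    have h3 := lt_of_le_of_lt b a
    rw [hδ, div_mul_eq_mul_div, lt_div_iff₀ (by positivity)] at h3
    have h4 := lt_of_mul_lt_mul_left h3 hc.le
    have := le_abs_self B
    linarith

end

section
variable {l : ℝ} {G ν ρ : Measure ℝ} [IsFiniteMeasure G] [IsProbabilityMeasure ν] [IsProbabilityMeasure ρ]

lemma seq_reg (S : SubS l G ν ρ) {x : ℝ} (hx : 0 < x) {δ : ℝ} (hδ : 0 < δ) {z : ℕ → ℂ}
    (hz : Tendsto z atTop (𝓝 (x : ℂ))) (him : ∀ n, 0 < (z n).im)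
    (hcone : ∀ n, δ * (1 + ‖Mt ρ (z n)‖) ≤ (Mt ρ (z n)).im) : x ∈ Xreg ρ ∪ Exc l G ν := by
  by_cases hM : Tendsto (fun n => ‖Mt ρ (z n)‖) atTop atTop
  · exact (no_infty S hx hδ hz him hM fun n => by have := hcone n; linarith).elim
  · rw [tendsto_atTop] at hM
    push Not at hM
    obtain ⟨B, hB⟩ := hM
    have hf : ∃ᶠ n in atTop, Mt ρ (z n) ∈ Metric.closedBall (0 : ℂ) B := by
      refine hB.mono fun n hn => ?_
      rw [mem_closedBall_zero_iff]; exact hn.le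
    obtain ⟨M0, -, φ, hφ, hlim⟩ := tendsto_subseq_of_frequently_bounded Metric.isBounded_closedBall hf
    refine case_a S hx (z := z ∘ φ) (hz.comp hφ.tendsto_atTop) (fun n => him _) hlim ?_
    have := (Complex.continuous_im.tendsto _).comp hlim
    refine lt_of_lt_of_le hδ (ge_of_tendsto' this fun n => ?_)
    have := hcone (φ n)
    have := mul_nonneg hδ.le (norm_nonneg (Mt ρ (z (φ n))))
    simp only [Function.comp]
    linarith

lemma inv_sq_im_pos {w : ℂ} (h1 : 0 < w.im) (h2 : w.re < 0) : 0 < (1 / w ^ 2).im := by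
  have hne : w ≠ 0 := by rintro rfl; simp at h1
  rw [one_div, Complex.inv_im]
  apply div_pos _ (Complex.normSq_pos.2 (pow_ne_zero 2 hne))
  have : (w ^ 2).im = 2 * w.re * w.im := by rw [sq]; simp; ring
  rw [this]; nlinarith

lemma neg_reg (S : SubS l G ν ρ) (hs : Measure.map (fun t : ℝ => -t) ρ = ρ) {t : ℝ} (ht : t < 0)
    (h : ∃ δ > 0, ∃ᶠ w in 𝓝[UHP] (t : ℂ), δ * (1 + ‖Gt ρ w‖) ≤ (Gt ρ w).im) :
    1 / t ^ 2 ∈ Xreg ρ ∪ Exc l G ν := by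
  obtain ⟨δ, hδ, hfr⟩ := h
  have hU : ∀ᶠ w in 𝓝[UHP] (t : ℂ), w ∈ UHP := self_mem_nhdsWithin
  have hre : ∀ᶠ w in 𝓝[UHP] (t : ℂ), w.re < t / 2 := by
    apply nhdsWithin_le_nhds
    exact Complex.continuous_re.continuousAt.eventually (gt_mem_nhds (by simp; linarith))
  have him : ∀ᶠ w in 𝓝[UHP] (t : ℂ), w.im < δ * (-t) / 4 := by
    apply nhdsWithin_le_nhds
    refine Complex.continuous_im.continuousAt.eventually (gt_mem_nhds ?_)
    have := mul_pos hδ (neg_pos.2 ht)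
    simp only [ofReal_im]; linarith
  have hno : ∀ᶠ w in 𝓝[UHP] (t : ℂ), ‖w‖ < 2 * (-t) := by
    apply nhdsWithin_le_nhds
    refine continuous_norm.continuousAt.eventually (gt_mem_nhds ?_)
    simp only [Complex.norm_real, Real.norm_eq_abs, abs_of_neg ht]; linarith
  have hfr2 := hfr.and_eventually (hU.and (hre.and (him.and hno)))
  obtain ⟨w, hw, hp⟩ := Filter.exists_seq_forall_of_frequently hfr2
  have htC : (t : ℂ) ≠ 0 := by exact_mod_cast ht.ne
  refine seq_reg S (x := 1 / t ^ 2) (by have := ht.ne; positivity) (δ := δ * (-t) / (8 * (1 - t)))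
    (div_pos (mul_pos hδ (neg_pos.2 ht)) (by linarith)) (z := fun n => 1 / (w n) ^ 2) ?_ ?_ ?_
  · have h1 : Tendsto w atTop (𝓝 (t : ℂ)) := hw.mono_right nhdsWithin_le_nhds
    have := (tendsto_const_nhds (x := (1 : ℂ))).div (h1.pow 2) (pow_ne_zero 2 htC)
    push_cast
    exact this
  · intro n
    obtain ⟨-, a, b, -⟩ := hp n
    exact inv_sq_im_pos a (by linarith)
  · intro n
    obtain ⟨hc, a, b, c, d⟩ := hp n
    have a : 0 < (w n).im := a
    have e : Mt ρ (1 / w n ^ 2) = - w n * Gt ρ (w n) - 1 := by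
      linear_combination Gt_symm hs a
    rw [e]
    generalize w n = v at *
    generalize Gt ρ v = g at *
    have i1 : (-v * g - 1).im = -(v.re * g.im) - v.im * g.re := by simp; ring
    have i2 : ‖-v * g - 1‖ ≤ ‖v‖ * ‖g‖ + 1 := by
      refine (norm_sub_le _ _).trans ?_
      simp
    have i3 : |g.re| ≤ ‖g‖ := Complex.abs_re_le_norm _
    have i4 : v.im * g.re ≤ δ * (-t) / 4 * ‖g‖ :=
      calc v.im * g.re ≤ v.im * ‖g‖ := by gcongr; exact (le_abs_self _).trans i3
        _ ≤ _ := by gcongr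
    have i5 : (-t) / 2 * (δ * (1 + ‖g‖)) ≤ -(v.re * g.im) := by
      rw [← neg_mul]
      apply mul_le_mul (by linarith) hc (by positivity) (by linarith)
    have i6 : δ * (-t) / 4 * (1 + ‖g‖) ≤ (-v * g - 1).im := by
      rw [i1]; nlinarith [mul_pos hδ (neg_pos.2 ht)]
    refine le_trans ?_ i6
    have i7 : 1 + ‖-v * g - 1‖ ≤ 2 * (1 - t) * (1 + ‖g‖) := by
      have : ‖v‖ * ‖g‖ ≤ 2 * (-t) * ‖g‖ := by gcongr
      nlinarith [norm_nonneg g]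
    have h1t : 0 < 1 - t := by linarith
    have hc0 : 0 ≤ δ * (-t) / (8 * (1 - t)) := (div_pos (mul_pos hδ (neg_pos.2 ht)) (by linarith)).le
    calc _ ≤ δ * (-t) / (8 * (1 - t)) * (2 * (1 - t) * (1 + ‖g‖)) := mul_le_mul_of_nonneg_left i7 hc0
      _ = _ := by field_simp; ring

theorem ae_reg (S : SubS l G ν ρ) (hs : Measure.map (fun t : ℝ => -t) ρ = ρ) :
    ∀ᵐ t : ℝ ∂ρ, t ≠ 0 ∧ 1 / t ^ 2 ∈ Xreg ρ := by
  have hna : NullSingletonClass ρ := ⟨fun t => no_atoms S t⟩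
  have hmp : MeasurePreserving (fun t : ℝ => -t) ρ ρ := ⟨measurable_neg, hs⟩
  have h1 := lemN hs
  have h2 := hmp.quasiMeasurePreserving.ae h1
  have h0 : ∀ᵐ t : ℝ ∂ρ, t ≠ 0 := by
    rw [ae_iff]; simpa using no_atoms S 0
  have hE : ∀ᵐ t : ℝ ∂ρ, 1 / t ^ 2 ∉ Exc l G ν := by
    rw [ae_iff]
    have hc : ((fun x => 1 / √x) '' Exc l G ν ∪ (fun x => -(1 / √x)) '' Exc l G ν).Countable :=
      ((Exc_countable l G ν).image _).union ((Exc_countable l G ν).image _)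
    refine measure_mono_null ?_ (hc.measure_zero ρ)
    intro t ht
    have ht : 1 / t ^ 2 ∈ Exc l G ν := not_not.1 ht
    have e : 1 / √(1 / t ^ 2) = |t| := by
      rw [one_div (t ^ 2), Real.sqrt_inv, Real.sqrt_sq_eq_abs]; simp
    rcases le_total 0 t with h | h
    · exact Or.inl ⟨_, ht, by simp only [e, abs_of_nonneg h]⟩
    · exact Or.inr ⟨_, ht, by simp only [e, abs_of_nonpos h, neg_neg]⟩
  filter_upwards [h1, h2, h0, hE] with t a b c d
  refine ⟨c, ?_⟩
  rcases lt_or_gt_of_ne c with h | h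
  · exact (neg_reg S hs h a).resolve_right d
  · have := neg_reg S hs (t := -t) (by linarith) b
    rw [neg_sq] at this
    exact this.resolve_right d

end

section
variable {ρ : Measure ℝ} [IsProbabilityMeasure ρ]

def Ureg (ρ : Measure ℝ) : Set ℝ :=
  {t | ∃ E : ℂ → ℂ, AnalyticAt ℂ E (t : ℂ) ∧ ∀ᶠ w in 𝓝 (t : ℂ), 0 < w.im → Gt ρ w = E w}

lemma Ureg_of_neg (hs : Measure.map (fun t : ℝ => -t) ρ = ρ) {t : ℝ} (ht : t < 0) (h : 1 / t ^ 2 ∈ Xreg ρ) :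
    t ∈ Ureg ρ := by
  obtain ⟨hx, F, hF, hev⟩ := h
  have htC : (t : ℂ) ≠ 0 := by exact_mod_cast ht.ne
  have h1 : AnalyticAt ℂ (fun w : ℂ => 1 / w ^ 2) (t : ℂ) :=
    analyticAt_const.div (analyticAt_id.pow 2) (pow_ne_zero 2 htC)
  have he : (((1 / t ^ 2 : ℝ)) : ℂ) = 1 / (t : ℂ) ^ 2 := by push_cast; rfl
  rw [he] at hF hev
  refine ⟨fun w => -(1 + F (1 / w ^ 2)) / w, ?_, ?_⟩
  · exact ((analyticAt_const.add (AnalyticAt.comp (g := F) (f := fun w : ℂ => 1 / w ^ 2) hF h1)).neg).div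
      analyticAt_id htC
  · have h2 := h1.continuousAt.eventually hev
    have h3 : ∀ᶠ w in 𝓝 (t : ℂ), w.re < 0 :=
      Complex.continuous_re.continuousAt.eventually (gt_mem_nhds (by simpa using ht))
    filter_upwards [h2, h3] with w a b hw
    have hw0 : w ≠ 0 := by rintro rfl; simp at hw
    rw [← a (inv_sq_im_pos hw b), Gt_symm hs hw]
    field_simp

open ComplexConjugate in
lemma Gt_conj (hs : Measure.map (fun t : ℝ => -t) ρ = ρ) (w : ℂ) : Gt ρ w = - conj (Gt ρ (- conj w)) := by
  have h1 : Gt ρ w = ∫ t : ℝ, (-(t : ℂ) - w)⁻¹ ∂ρ := by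
    conv_lhs => rw [Gt, ← hs]
    rw [integral_map (by fun_prop) (Measurable.aestronglyMeasurable (by fun_prop))]
    simp
  rw [h1, Gt, ← integral_conj, ← integral_neg]
  congr 1
  ext t
  rw [map_inv₀, ← inv_neg]
  congr 1
  simp
  ring

open ComplexConjugate in
lemma Ureg_neg (hs : Measure.map (fun t : ℝ => -t) ρ = ρ) {t : ℝ} (h : -t ∈ Ureg ρ) :
    t ∈ Ureg ρ := by
  obtain ⟨E, hE, hev⟩ := h
  have hc : Tendsto (fun w : ℂ => - conj w) (𝓝 (t : ℂ)) (𝓝 ((-t : ℝ) : ℂ)) := by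
    have : Continuous (fun w : ℂ => - conj w) := by fun_prop
    have := this.tendsto (t : ℂ)
    simpa using this
  refine ⟨fun w => - conj (E (- conj w)), ?_, ?_⟩
  · rw [analyticAt_iff_eventually_differentiableAt] at hE ⊢
    filter_upwards [hc.eventually hE] with w hw
    have h2 : DifferentiableAt ℂ (fun v => E (-v)) (conj w) :=
      DifferentiableAt.comp (g := E) (f := fun v : ℂ => -v) (conj w) hw (by fun_prop)
    have := h2.conj_conj
    rw [Complex.conj_conj] at this
    exact this.neg
  · filter_upwards [hc.eventually hev] with w hw h0
    rw [← hw (by simpa using h0)]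
    exact Gt_conj hs w

lemma Ureg_loc {t : ℝ} (h : t ∈ Ureg ρ) : ∃ r > 0, ∃ E : ℂ → ℂ, (∀ w ∈ Metric.ball (t : ℂ) r, AnalyticAt ℂ E w) ∧
    ∀ w ∈ Metric.ball (t : ℂ) r, 0 < w.im → Gt ρ w = E w := by
  obtain ⟨E, hE, hev⟩ := h
  obtain ⟨r, hr, hb⟩ := Metric.eventually_nhds_iff_ball.1 (hE.eventually_analyticAt.and hev)
  exact ⟨r, hr, E, fun w hw => (hb w hw).1, fun w hw => (hb w hw).2⟩

lemma real_mem_ball {t s r : ℝ} : (s : ℂ) ∈ Metric.ball (t : ℂ) r ↔ s ∈ Metric.ball t r := by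
  rw [Metric.mem_ball, Metric.mem_ball, Complex.dist_eq, ← Complex.ofReal_sub, Complex.norm_real, Real.dist_eq,
    Real.norm_eq_abs]

lemma Ureg_ball {t r : ℝ} {E : ℂ → ℂ} (h1 : ∀ w ∈ Metric.ball (t : ℂ) r, AnalyticAt ℂ E w)
    (h2 : ∀ w ∈ Metric.ball (t : ℂ) r, 0 < w.im → Gt ρ w = E w) : Metric.ball t r ⊆ Ureg ρ := by
  intro s hs
  have hs := real_mem_ball.2 hs
  exact ⟨E, h1 _ hs, by filter_upwards [Metric.isOpen_ball.mem_nhds hs] with w hw using h2 w hw⟩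

lemma Ureg_open : IsOpen (Ureg ρ) := by
  rw [Metric.isOpen_iff]
  intro t ht
  obtain ⟨r, hr, E, h1, h2⟩ := Ureg_loc ht
  exact ⟨r, hr, Ureg_ball h1 h2⟩

def dens (ρ : Measure ℝ) (t : ℝ) : ℝ := (limUnder (𝓝[UHP] (t : ℂ)) (Gt ρ)).im / Real.pi

lemma tendsto_UHP (t : ℝ) : Tendsto (fun n : ℕ => (t : ℂ) + (1 / ((n : ℝ) + 1) : ℝ) * I) atTop (𝓝[UHP] (t : ℂ)) := by
  refine tendsto_nhdsWithin_of_tendsto_nhds_of_eventually_within _ ?_ (Eventually.of_forall fun n => ?_)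
  · have := (Complex.continuous_ofReal.tendsto 0).comp (eps_tendsto 1)
    have := (this.mul_const I).const_add (t : ℂ)
    simpa [Function.comp_def] using this
  · show 0 < ((t : ℂ) + (1 / ((n : ℝ) + 1) : ℝ) * I).im
    simpa only [Complex.add_im, Complex.ofReal_im, Complex.im_ofReal_mul, Complex.I_im, mul_one, zero_add]
      using (eps_mem one_pos n).1

instance UHP_neBot (t : ℝ) : (𝓝[UHP] (t : ℂ)).NeBot := (tendsto_UHP t).neBot

lemma dens_eq {t r : ℝ} {E : ℂ → ℂ} (h1 : ∀ w ∈ Metric.ball (t : ℂ) r, AnalyticAt ℂ E w)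
    (h2 : ∀ w ∈ Metric.ball (t : ℂ) r, 0 < w.im → Gt ρ w = E w) {s : ℝ} (hs : s ∈ Metric.ball t r) :
    dens ρ s = (E s).im / Real.pi := by
  have hs := real_mem_ball.2 hs
  have ht : Tendsto (Gt ρ) (𝓝[UHP] (s : ℂ)) (𝓝 (E s)) := by
    have := (h1 _ hs).continuousAt.tendsto.mono_left (nhdsWithin_le_nhds (s := UHP))
    refine this.congr' ?_
    filter_upwards [nhdsWithin_le_nhds (Metric.isOpen_ball.mem_nhds hs), self_mem_nhdsWithin] with w hw hu
    exact (h2 w hw hu).symm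
  rw [dens, ht.limUnder_eq]

lemma dens_nonneg {t : ℝ} (h : t ∈ Ureg ρ) : 0 ≤ dens ρ t := by
  obtain ⟨r, hr, E, h1, h2⟩ := Ureg_loc h
  rw [dens_eq h1 h2 (Metric.mem_ball_self hr)]
  apply div_nonneg _ Real.pi_pos.le
  have h3 : ContinuousAt E (t : ℂ) := (h1 _ (Metric.mem_ball_self hr)).continuousAt
  have h4 := (Complex.continuous_im.continuousAt.comp h3).tendsto.comp
    ((tendsto_UHP t).mono_right nhdsWithin_le_nhds)
  refine ge_of_tendsto h4 ?_
  filter_upwards [((tendsto_UHP t).mono_right nhdsWithin_le_nhds).eventually (Metric.ball_mem_nhds _ hr)] with n hn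
  have hp := (eps_mem one_pos n).1
  simp only [Function.comp]
  rw [← h2 _ hn (by
    simpa only [Complex.add_im, Complex.ofReal_im, Complex.im_ofReal_mul, Complex.I_im, mul_one, zero_add] using hp)]
  exact Gt_im_nonneg ρ hp

lemma dens_an {t : ℝ} (h : t ∈ Ureg ρ) : AnalyticAt ℝ (dens ρ) t := by
  obtain ⟨r, hr, E, h1, h2⟩ := Ureg_loc h
  have hE : AnalyticAt ℝ E (t : ℂ) := (h1 _ (Metric.mem_ball_self hr)).restrictScalars
  have h3 : AnalyticAt ℝ (fun s : ℝ => E (s : ℂ)) t :=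
    AnalyticAt.comp (g := E) (f := fun s : ℝ => (s : ℂ)) hE (Complex.ofRealCLM.analyticAt t)
  have h4 : AnalyticAt ℝ (fun s : ℝ => (E (s : ℂ)).im) t :=
    AnalyticAt.comp (g := Complex.im) (f := fun s : ℝ => E (s : ℂ)) (Complex.imCLM.analyticAt _) h3
  have h5 : AnalyticAt ℝ (fun s : ℝ => (E (s : ℂ)).im / Real.pi) t :=
    h4.div analyticAt_const Real.pi_ne_zero
  refine h5.congr ?_
  filter_upwards [Metric.ball_mem_nhds t hr] with s hs
  exact (dens_eq h1 h2 hs).symm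

end

section
variable {ρ : Measure ℝ} [IsProbabilityMeasure ρ]

lemma pois_int (s a b : ℝ) {y : ℝ} (hy : 0 < y) :
    ∫ u in a..b, y / ((s - u) ^ 2 + y ^ 2) = Real.arctan ((b - s) / y) - Real.arctan ((a - s) / y) := by
  have hd : ∀ u : ℝ, HasDerivAt (fun u => Real.arctan ((u - s) / y)) (y / ((s - u) ^ 2 + y ^ 2)) u := by
    intro u
    have h1 : HasDerivAt (fun u : ℝ => (u - s) / y) (1 / y) u := ((hasDerivAt_id u).sub_const s).div_const y
    refine h1.arctan.congr_deriv ?_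
    have : (s - u) ^ 2 + y ^ 2 ≠ 0 := by positivity
    have : y ^ 2 + (u - s) ^ 2 ≠ 0 := by positivity
    field_simp
    ring
  refine intervalIntegral.integral_eq_sub_of_hasDerivAt (fun u _ => hd u) ?_
  refine Continuous.intervalIntegrable ?_ _ _
  refine continuous_const.div (by fun_prop) fun u => by positivity

lemma Gt_im_int (ρ : Measure ℝ) [IsProbabilityMeasure ρ] (a b : ℝ) {y : ℝ} (hy : 0 < y) :
    ∫ u in a..b, (Gt ρ (u + y * I)).im =
      ∫ s : ℝ, (Real.arctan ((b - s) / y) - Real.arctan ((a - s) / y)) ∂ρ := by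
  simp only [Gt_im ρ hy]
  rw [intervalIntegral_integral_swap]
  · simp only [pois_int _ _ _ hy]
  · have : IsFiniteMeasure (volume.restrict (uIoc a b)) := by
      rw [uIoc]; infer_instance
    refine Integrable.of_bound (Measurable.aestronglyMeasurable ?_) (1 / y) (Eventually.of_forall fun p => ?_)
    · simp only [Function.uncurry_def]; fun_prop
    · simp only [Function.uncurry_def]
      rw [Real.norm_eq_abs, abs_of_nonneg (by positivity), div_le_div_iff₀ (by positivity) hy]
      nlinarith [sq_nonneg (p.2 - p.1)]

lemma arctan_lim_pos {c : ℝ} (hc : 0 < c) :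
    Tendsto (fun n : ℕ => Real.arctan (c / (1 / ((n : ℝ) + 1)))) atTop (𝓝 (Real.pi / 2)) := by
  have h1 : Tendsto (fun n : ℕ => c / (1 / ((n : ℝ) + 1))) atTop atTop := by
    have : Tendsto (fun n : ℕ => c * ((n : ℝ) + 1)) atTop atTop :=
      (tendsto_atTop_add_const_right _ _ tendsto_natCast_atTop_atTop).const_mul_atTop hc
    refine this.congr fun n => ?_
    field_simp
  exact (Real.tendsto_arctan_atTop.mono_right nhdsWithin_le_nhds).comp h1

lemma arctan_lim_neg {c : ℝ} (hc : c < 0) :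
    Tendsto (fun n : ℕ => Real.arctan (c / (1 / ((n : ℝ) + 1)))) atTop (𝓝 (-(Real.pi / 2))) := by
  have := (arctan_lim_pos (neg_pos.2 hc)).neg
  refine this.congr fun n => ?_
  rw [neg_div, Real.arctan_neg, neg_neg]

lemma stieltjes_lim (ρ : Measure ℝ) [IsProbabilityMeasure ρ] (hna : ∀ t, ρ {t} = 0) {a b : ℝ} (hab : a < b) :
    Tendsto (fun n : ℕ => ∫ u in a..b, (Gt ρ (u + (1 / ((n : ℝ) + 1) : ℝ) * I)).im) atTop
      (𝓝 (ρ.real (Ioc a b) * Real.pi)) := by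
  have e : ∀ n : ℕ, ∫ u in a..b, (Gt ρ (u + (1 / ((n : ℝ) + 1) : ℝ) * I)).im = 
    ∫ s : ℝ, (Real.arctan ((b - s) / (1 / ((n : ℝ) + 1))) - Real.arctan ((a - s) / (1 / ((n : ℝ) + 1)))) ∂ρ :=
    fun n => Gt_im_int ρ a b (eps_mem one_pos n).1
  simp only [e]
  have e2 : ρ.real (Ioc a b) * Real.pi = ∫ s : ℝ, (Ioc a b).indicator (fun _ => Real.pi) s ∂ρ := by
    rw [integral_indicator measurableSet_Ioc, setIntegral_const, smul_eq_mul]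
  rw [e2]
  refine tendsto_integral_of_dominated_convergence (fun _ => Real.pi) ?_ (integrable_const _) ?_ ?_
  · intro n
    refine Measurable.aestronglyMeasurable ?_
    exact (Real.measurable_arctan.comp (by fun_prop)).sub (Real.measurable_arctan.comp (by fun_prop))
  · intro n
    refine Eventually.of_forall fun s => ?_
    rw [Real.norm_eq_abs, abs_le]
    constructor
    · linarith [Real.neg_pi_div_two_lt_arctan ((b - s) / (1 / ((n : ℝ) + 1))),
        Real.arctan_lt_pi_div_two ((a - s) / (1 / ((n : ℝ) + 1)))]
    · linarith [Real.neg_pi_div_two_lt_arctan ((a - s) / (1 / ((n : ℝ) + 1))),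
        Real.arctan_lt_pi_div_two ((b - s) / (1 / ((n : ℝ) + 1)))]
  · have ha : ∀ᵐ s : ℝ ∂ρ, s ≠ a := by rw [ae_iff]; simpa using hna a
    have hb : ∀ᵐ s : ℝ ∂ρ, s ≠ b := by rw [ae_iff]; simpa using hna b
    filter_upwards [ha, hb] with s h1 h2
    rcases lt_or_gt_of_ne h1 with h1 | h1
    · rw [indicator_of_notMem (fun h => absurd h.1 (not_lt.2 h1.le))]
      have := (arctan_lim_pos (show 0 < b - s by linarith)).sub (arctan_lim_pos (show 0 < a - s by linarith))
      simpa using this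
    · rcases lt_or_gt_of_ne h2 with h2 | h2
      · rw [indicator_of_mem (show s ∈ Ioc a b from ⟨h1, h2.le⟩)]
        have := (arctan_lim_pos (show 0 < b - s by linarith)).sub (arctan_lim_neg (show a - s < 0 by linarith))
        have e3 : Real.pi / 2 - -(Real.pi / 2) = Real.pi := by ring
        rw [e3] at this
        exact this
      · rw [indicator_of_notMem (fun h => absurd h.2 (not_le.2 h2))]
        have := (arctan_lim_neg (show b - s < 0 by linarith)).sub (arctan_lim_neg (show a - s < 0 by linarith))
        simpa using this

lemma loc_dens (hs : Measure.map (fun t : ℝ => -t) ρ = ρ) (hna : ∀ t, ρ {t} = 0) {t : ℝ} (h : t ∈ Ureg ρ) :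
    ∃ r > 0, Icc (t - r) (t + r) ⊆ Ureg ρ ∧ ∀ a b, t - r ≤ a → a < b → b ≤ t + r →
      ρ.real (Ioc a b) = ∫ u in a..b, dens ρ u := by
  obtain ⟨R, hR, E, h1, h2⟩ := Ureg_loc h
  set r := R / 4 with hr
  have hrp : 0 < r := by positivity
  have hIcc : Icc (t - r) (t + r) ⊆ Metric.ball t R := by
    intro s hs
    rw [Metric.mem_ball, Real.dist_eq, abs_lt]
    constructor <;> linarith [hs.1, hs.2]
  refine ⟨r, hrp, hIcc.trans (Ureg_ball h1 h2), fun a b ha hab hb => ?_⟩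
  have hlim1 := stieltjes_lim ρ hna hab
  have hballC : ∀ u ∈ Icc (t - r) (t + r), ∀ y ∈ Icc 0 r, (u : ℂ) + (y : ℝ) * I ∈ Metric.closedBall (t : ℂ) (R / 2) := by
    intro u hu y hy
    rw [mem_closedBall_iff_norm]
    have : (u : ℂ) + y * I - t = ((u - t : ℝ) : ℂ) + y * I := by push_cast; ring
    rw [this]
    refine (norm_add_le _ _).trans ?_
    rw [norm_mul, Complex.norm_I, mul_one, Complex.norm_real, Complex.norm_real, Real.norm_eq_abs, Real.norm_eq_abs,
      abs_of_nonneg hy.1]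
    have : |u - t| ≤ r := by
      rw [abs_le]; constructor <;> linarith [hu.1, hu.2]
    linarith [hy.2]
  have hsubb : Metric.closedBall (t : ℂ) (R / 2) ⊆ Metric.ball (t : ℂ) R :=
    Metric.closedBall_subset_ball (by linarith)
  have hcE : ContinuousOn E (Metric.closedBall (t : ℂ) (R / 2)) := fun w hw =>
    (h1 w (hsubb hw)).continuousAt.continuousWithinAt
  obtain ⟨B, hB⟩ := (isCompact_closedBall (t : ℂ) (R / 2)).exists_bound_of_continuousOn hcE
  have hlim2 : Tendsto (fun n : ℕ => ∫ u in a..b, (Gt ρ (u + (1 / ((n : ℝ) + 1) : ℝ) * I)).im) atTop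
      (𝓝 (∫ u in a..b, (E u).im)) := by
    have hev : ∀ᶠ n : ℕ in atTop, 1 / ((n : ℝ) + 1) < r := (eps_tendsto 1).eventually (gt_mem_nhds hrp)
    refine intervalIntegral.tendsto_integral_filter_of_dominated_convergence (fun _ => B) ?_ ?_
      intervalIntegrable_const ?_
    · refine Eventually.of_forall fun n => ?_
      have := Gt_cont_line hs (eps_mem one_pos n).1
      exact (Complex.continuous_im.comp this).aestronglyMeasurable
    · filter_upwards [hev] with n hn
      refine Eventually.of_forall fun u hu => ?_
      rw [uIoc_of_le hab.le] at hu
      have hp := (eps_mem one_pos n).1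
      have hm := hballC u ⟨by linarith [hu.1], by linarith [hu.2]⟩ _ ⟨hp.le, hn.le⟩
      rw [h2 _ (hsubb hm) (by
        simpa only [Complex.add_im, Complex.ofReal_im, Complex.im_ofReal_mul, Complex.I_im, mul_one, zero_add] using hp)]
      exact (Complex.abs_im_le_norm _).trans (hB _ hm)
    · refine Eventually.of_forall fun u hu => ?_
      rw [uIoc_of_le hab.le] at hu
      have hu' : u ∈ Icc (t - r) (t + r) := ⟨by linarith [hu.1], by linarith [hu.2]⟩
      have hub := real_mem_ball.2 (hIcc hu')
      have hc : ContinuousAt (fun w => (E w).im) (u : ℂ) :=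
        Complex.continuous_im.continuousAt.comp (h1 _ hub).continuousAt
      have ht := (tendsto_UHP u).mono_right nhdsWithin_le_nhds
      refine (hc.tendsto.comp ht).congr' ?_
      filter_upwards [hev] with n hn
      have hp := (eps_mem one_pos n).1
      have hm := hballC u hu' _ ⟨hp.le, hn.le⟩
      simp only [Function.comp]
      rw [h2 _ (hsubb hm) (by
        simpa only [Complex.add_im, Complex.ofReal_im, Complex.im_ofReal_mul, Complex.I_im, mul_one, zero_add] using hp)]
  have heq := tendsto_nhds_unique hlim1 hlim2
  have : ∫ u in a..b, dens ρ u = ∫ u in a..b, (E u).im / Real.pi := by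
    refine intervalIntegral.integral_congr fun u hu => ?_
    rw [uIcc_of_le hab.le] at hu
    exact dens_eq h1 h2 (hIcc ⟨by linarith [hu.1], by linarith [hu.2]⟩)
  rw [this, intervalIntegral.integral_div, ← heq]
  field_simp

lemma dens_cont : ContinuousOn (dens ρ) (Ureg ρ) := fun t ht =>
  (dens_an ht).continuousAt.continuousWithinAt

lemma loc_restrict (hs : Measure.map (fun t : ℝ => -t) ρ = ρ) (hna : ∀ t, ρ {t} = 0) {t : ℝ} (h : t ∈ Ureg ρ) :
    ∃ r > 0, ρ.restrict (Ioo (t - r) (t + r)) =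
      (volume.withDensity (fun x => ENNReal.ofReal ((Ureg ρ).indicator (dens ρ) x))).restrict (Ioo (t - r) (t + r)) := by
  obtain ⟨r, hr, hsub, hint⟩ := loc_dens hs hna h
  refine ⟨r, hr, Measure.restrict_congr_mono (t := Ioc (t - r) (t + r)) Ioo_subset_Ioc_self ?_⟩
  refine Measure.ext_of_Ioc _ _ fun a b hab => ?_
  rw [Measure.restrict_apply measurableSet_Ioc, Measure.restrict_apply measurableSet_Ioc, Ioc_inter_Ioc]
  set a' := a ⊔ (t - r)
  set b' := b ⊓ (t + r)
  have ha' : t - r ≤ a' := le_sup_right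
  have hb' : b' ≤ t + r := inf_le_right
  rcases lt_or_ge a' b' with hlt | hge
  · rw [withDensity_apply _ measurableSet_Ioc]
    have hss : Icc a' b' ⊆ Ureg ρ := (Icc_subset_Icc ha' hb').trans hsub
    have e1 : ∫⁻ x in Ioc a' b', ENNReal.ofReal ((Ureg ρ).indicator (dens ρ) x) =
        ∫⁻ x in Ioc a' b', ENNReal.ofReal (dens ρ x) := by
      refine setLIntegral_congr_fun measurableSet_Ioc fun x hx => ?_
      beta_reduce
      rw [indicator_of_mem (hss (Ioc_subset_Icc_self hx))]
    have hio : IntegrableOn (dens ρ) (Ioc a' b') :=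
      ((dens_cont.mono hss).integrableOn_Icc).mono_set Ioc_subset_Icc_self
    rw [e1, ← ofReal_integral_eq_lintegral_ofReal hio]
    · rw [← intervalIntegral.integral_of_le hlt.le, ← hint a' b' ha' hlt hb', ofReal_measureReal]
    · rw [EventuallyLE, ae_restrict_iff' measurableSet_Ioc]
      exact Eventually.of_forall fun x hx => dens_nonneg (hss (Ioc_subset_Icc_self hx))
  · rw [Ioc_eq_empty (not_lt.2 hge)]; simp

theorem final_dens (hs : Measure.map (fun t : ℝ => -t) ρ = ρ) (hna : ∀ t, ρ {t} = 0)
    (hae : ∀ᵐ t ∂ρ, t ∈ Ureg ρ) :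
    ρ = volume.withDensity (fun x => ENNReal.ofReal ((Ureg ρ).indicator (dens ρ) x)) := by
  set τ := volume.withDensity (fun x => ENNReal.ofReal ((Ureg ρ).indicator (dens ρ) x)) with hτ
  choose! r hr hreq using fun t (h : t ∈ Ureg ρ) => loc_restrict hs hna h
  obtain ⟨T, hTU, hTc, hT⟩ := TopologicalSpace.isOpen_biUnion_countable (Ureg ρ)
    (fun t => Ioo (t - r t) (t + r t)) (fun _ _ => isOpen_Ioo)
  have h1 := (Measure.restrict_biUnion_congr (μ := ρ) (ν := τ) hTc (t := fun t => Ioo (t - r t) (t + r t))).2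
    (fun t ht => hreq t (hTU ht))
  have hcov : Ureg ρ ⊆ ⋃ i ∈ T, Ioo (i - r i) (i + r i) := by
    rw [hT]
    intro t ht
    exact mem_biUnion ht ⟨by linarith [hr t ht], by linarith [hr t ht]⟩
  have hU := Measure.restrict_congr_mono hcov h1
  have hm : MeasurableSet (Ureg ρ) := Ureg_open.measurableSet
  have hUc : ρ.restrict (Ureg ρ)ᶜ = τ.restrict (Ureg ρ)ᶜ := by
    rw [Measure.restrict_eq_zero.2 (show ρ (Ureg ρ)ᶜ = 0 from hae), eq_comm, Measure.restrict_eq_zero, hτ,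
      withDensity_apply _ hm.compl]
    rw [setLIntegral_congr_fun (g := fun _ => 0) hm.compl]
    · simp
    · intro x hx
      beta_reduce
      rw [indicator_of_notMem hx, ENNReal.ofReal_zero]
  rw [← Measure.restrict_add_restrict_compl (μ := ρ) hm, hU, hUc, Measure.restrict_add_restrict_compl hm]

theorem main18 {l : ℝ} {G ν : Measure ℝ} [IsFiniteMeasure G] [IsProbabilityMeasure ν]
    (S : SubS l G ν ρ) (hs : Measure.map (fun t : ℝ => -t) ρ = ρ) :
    ∃ f : ℝ → ℝ, ρ = volume.withDensity (fun x => ENNReal.ofReal (f x)) ∧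
      ∃ U : Set ℝ, IsOpen U ∧ ρ U = 1 ∧ AnalyticOnNhd ℝ f U := by
  have hae : ∀ᵐ t ∂ρ, t ∈ Ureg ρ := by
    filter_upwards [ae_reg S hs] with t ht
    rcases lt_or_gt_of_ne ht.1 with h | h
    · exact Ureg_of_neg hs h ht.2
    · apply Ureg_neg hs
      exact Ureg_of_neg hs (by linarith) (by rw [neg_sq]; exact ht.2)
  refine ⟨_, final_dens hs (no_atoms S) hae, Ureg ρ, Ureg_open, ?_, ?_⟩
  · exact prob_compl_eq_zero_iff Ureg_open.measurableSet |>.1 hae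
  · intro t ht
    refine (dens_an ht).congr ?_
    filter_upwards [Ureg_open.mem_nhds ht] with s hs
    rw [indicator_of_mem hs]

end

/-- Assume moreover that `lim_{x→-∞} C(x)²/x` exists in `[-∞,0]` and is
nonzero, and that `C|ℂ⁺` extends continuously to `(0,+∞)` with boundary values in `ℂ⁺`.
Then `ρ = μ ⊞_λ ν` is absolutely continuous, and there is an open set `U ⊆ ℝ` of full
`ρ`-measure on which the density is real-analytic. -/
theorem stmt18 (l : ℝ) (hl : l ∈ Set.Ioo (0 : ℝ) 1)
    (μ : Measure ℝ) [IsProbabilityMeasure μ] (hμ0 : μ ≠ Measure.dirac (0 : ℝ))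
    (hμsym : Measure.map (fun t : ℝ => -t) μ = μ)
    (G : Measure ℝ) [IsFiniteMeasure G]
    (hGsym : Measure.map (fun t : ℝ => -t) G = G)
    (hID : IsRectInfDiv l μ G)
    (ν ρ : Measure ℝ) [IsProbabilityMeasure ν] [IsProbabilityMeasure ρ]
    (hνsym : Measure.map (fun t : ℝ => -t) ν = ν)
    (hρsym : Measure.map (fun t : ℝ => -t) ρ = ρ)
    (hconv : IsRectConv l G ν ρ)
    (hC2 : ∃ L : EReal, L ≤ 0 ∧ L ≠ 0 ∧
      Tendsto (fun x : ℝ => (((rectC G (x : ℂ)) ^ 2 / (x : ℂ)).re : EReal)) atBot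
        (nhds L))
    (hCb : ∃ Cb : ℂ → ℂ,
      ContinuousOn Cb (UHP ∪ ((fun x : ℝ => (x : ℂ)) '' Set.Ioi (0 : ℝ))) ∧
      (∀ z ∈ UHP, Cb z = rectC G z) ∧
      (∀ x : ℝ, 0 < x → 0 < (Cb (x : ℂ)).im)) :
    ∃ f : ℝ → ℝ, ρ = volume.withDensity (fun x => ENNReal.ofReal (f x)) ∧
      ∃ U : Set ℝ, IsOpen U ∧ ρ U = 1 ∧ AnalyticOnNhd ℝ f U := by
  exact main18 (SubS.mk' l G ν ρ hl hconv hC2) hρsym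

end
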